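/- arXiv:2504.10161 — 2 statements merged into one kernel-verified Lean document; each statement's English description precedes it below -/
import Mathlib

section
/- Let μ, κ, γ, M₀, T₀ > 0, let (P,γ) be an admissible pair with pressure potential W, and let (ρ,u,c) be a smooth periodic solution of the non-local Navier–Stokes–Korteweg system on [0,T₀) with initial data (ρ₀,u₀) satisfying M₀⁻¹ ≤ ρ₀(x) ≤ M₀ for all x. Then there exists a constant C(T₀) > 0, depending only on ‖ρ₀‖_{H¹(𝕋)}, ‖u₀‖_{H¹(𝕋)}, M₀, μ, κ, γ, W and T₀, such that sup_{t∈[0,T₀)} ‖u(t,·)‖_{H¹(𝕋)} ≤ C(T₀). -/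
open MeasureTheory Filter Set

/-- The `L²` norm of a `1`-periodic function, computed over one period. -/
noncomputable def L2norm (f : ℝ → ℝ) : ℝ := Real.sqrt (∫ x in (0:ℝ)..1, f x ^ 2)

/-- The `H¹` norm of a `1`-periodic function, computed over one period. -/
noncomputable def H1norm (f : ℝ → ℝ) : ℝ :=
  Real.sqrt (∫ x in (0:ℝ)..1, f x ^ 2 + deriv f x ^ 2)

/-- The `H²` norm of a `1`-periodic function, computed over one period. -/
noncomputable def H2norm (f : ℝ → ℝ) : ℝ :=
  Real.sqrt (∫ x in (0:ℝ)..1, f x ^ 2 + deriv f x ^ 2 + deriv (deriv f) x ^ 2)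

/-- The sup-norm of a `1`-periodic function, computed over one period. -/
noncomputable def LinfNorm (f : ℝ → ℝ) : ℝ := sSup ((fun x => |f x|) '' Set.Icc (0:ℝ) 1)

/-- The `W^{1,∞}` norm of a `1`-periodic function. -/
noncomputable def W1infNorm (f : ℝ → ℝ) : ℝ := LinfNorm f + LinfNorm (deriv f)

/-- The artificial pressure `P_γ(r) = P(r) + (γ/2) r²`. -/
noncomputable def artificialPressure (P : ℝ → ℝ) (γ : ℝ) (r : ℝ) : ℝ := P r + γ / 2 * r ^ 2

/-- A pair `(P, γ)` is admissible (with exponent `β` and limit `a`). -/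
structure IsAdmissiblePair (P : ℝ → ℝ) (γ β a : ℝ) : Prop where
  gamma_pos : 0 < γ
  beta_ge : 2 ≤ β
  a_pos : 0 < a
  nonneg : ∀ r, 0 ≤ r → 0 ≤ P r
  smooth : ContDiffOn ℝ 1 P (Set.Ici 0)
  zero : P 0 = 0
  lim : Filter.Tendsto (fun r => deriv P r / r ^ (β - 1)) Filter.atTop (nhds a)
  mono : MonotoneOn (artificialPressure P γ) (Set.Ici 0)

/-- `W` is a pressure potential for `P`: `W : [0,∞) → [0,∞)`, twice continuously
differentiable on `(0,∞)`, with `W''(r)·r = P'(r)` for `r > 0`. -/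
structure IsPressurePotential (P W : ℝ → ℝ) : Prop where
  nonneg : ∀ r, 0 ≤ r → 0 ≤ W r
  smooth : ContDiffOn ℝ 2 W (Set.Ioi 0)
  relation : ∀ r : ℝ, 0 < r → deriv (deriv W) r * r = deriv P r

/-- A smooth `1`-periodic-in-space solution of the non-local Navier–Stokes–Korteweg
system on the time set `S`, with initial data `(ρ₀, u₀)`. -/
structure IsNSKSolution (μ κ γ : ℝ) (P : ℝ → ℝ) (S : Set ℝ)
    (ρ u c : ℝ → ℝ → ℝ) (ρ₀ u₀ : ℝ → ℝ) : Prop where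
  smooth_rho : ContDiffOn ℝ (⊤ : ℕ∞) (fun p : ℝ × ℝ => ρ p.1 p.2) (S ×ˢ (Set.univ : Set ℝ))
  smooth_u : ContDiffOn ℝ (⊤ : ℕ∞) (fun p : ℝ × ℝ => u p.1 p.2) (S ×ˢ (Set.univ : Set ℝ))
  smooth_c : ContDiffOn ℝ (⊤ : ℕ∞) (fun p : ℝ × ℝ => c p.1 p.2) (S ×ˢ (Set.univ : Set ℝ))
  periodic_rho : ∀ t x, ρ t (x + 1) = ρ t x
  periodic_u : ∀ t x, u t (x + 1) = u t x
  periodic_c : ∀ t x, c t (x + 1) = c t x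
  rho_pos : ∀ t x, 0 < ρ t x
  mass : ∀ t ∈ S, ∀ x : ℝ,
    deriv (fun s => ρ s x) t + deriv (fun y => ρ t y * u t y) x = 0
  momentum : ∀ t ∈ S, ∀ x : ℝ,
    deriv (fun s => ρ s x * u s x) t
      + deriv (fun y => ρ t y * u t y ^ 2) x
      + deriv (fun y => P (ρ t y)) x
      - μ * deriv (deriv (u t)) x
      - γ * ρ t x * deriv (fun y => c t y - ρ t y) x = 0
  elliptic : ∀ t ∈ S, ∀ x : ℝ,
    -κ * deriv (deriv (c t)) x + γ * (c t x - ρ t x) = 0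
  init_rho : ∀ x, ρ 0 x = ρ₀ x
  init_u : ∀ x, u 0 x = u₀ x

namespace NSK

open scoped Topology Interval

/-- The spatial derivative of a function of time and space. -/
noncomputable def dx (f : ℝ → ℝ → ℝ) : ℝ → ℝ → ℝ := fun t x => deriv (f t) x

/-- The time derivative of a function of time and space. -/
noncomputable def dt (f : ℝ → ℝ → ℝ) : ℝ → ℝ → ℝ := fun t x => deriv (fun s => f s x) t

/-- Joint smoothness on `I × ℝ`. -/
def Sm (I : Set ℝ) (f : ℝ → ℝ → ℝ) : Prop :=
  ContDiffOn ℝ (⊤ : ℕ∞) (fun p : ℝ × ℝ => f p.1 p.2) (I ×ˢ (univ : Set ℝ))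

/-- Joint continuity on `I × ℝ`. -/
def Ct (I : Set ℝ) (f : ℝ → ℝ → ℝ) : Prop :=
  ContinuousOn (fun p : ℝ × ℝ => f p.1 p.2) (I ×ˢ (univ : Set ℝ))

section Calculus

variable {I J : Set ℝ} {f : ℝ → ℝ → ℝ} {t x T : ℝ}

lemma Sm.ct (h : Sm I f) : Ct I f := ContDiffOn.continuousOn h

lemma Sm.mono (h : Sm I f) (hJ : J ⊆ I) : Sm J f :=
  ContDiffOn.mono h (prod_mono hJ subset_rfl)

lemma Ct.mono (h : Ct I f) (hJ : J ⊆ I) : Ct J f :=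
  ContinuousOn.mono h (prod_mono hJ subset_rfl)

lemma Ct.continuous (h : Ct I f) (ht : t ∈ I) : Continuous (f t) := by
  have h2 : Continuous fun x : ℝ => (t, x) := by fun_prop
  exact ContinuousOn.comp_continuous (f := fun x : ℝ => (t, x)) h h2 fun x => ⟨ht, mem_univ _⟩

lemma Sm.hasDerivAt_fderivWithin (h : Sm I f) (ht : t ∈ I) (x : ℝ) :
    HasDerivAt (f t)
      (fderivWithin ℝ (fun p : ℝ × ℝ => f p.1 p.2) (I ×ˢ univ) (t, x) (0, 1)) x := by
  have h1 := ((ContDiffOn.differentiableOn h (by simp)) (t, x)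
    ⟨ht, mem_univ _⟩).hasFDerivWithinAt
  have h2 : HasDerivAt (fun y : ℝ => (t, y)) ((0 : ℝ), (1 : ℝ)) x :=
    (hasDerivAt_const x t).prodMk (hasDerivAt_id x)
  exact h1.comp_hasDerivAt x h2 (Eventually.of_forall fun y => ⟨ht, mem_univ _⟩)

lemma Sm.hasDerivAt_dx (h : Sm I f) (ht : t ∈ I) (x : ℝ) : HasDerivAt (f t) (dx f t x) x :=
  (h.hasDerivAt_fderivWithin ht x).differentiableAt.hasDerivAt

lemma Sm.dx (h : Sm I f) (hI : UniqueDiffOn ℝ I) : Sm I (dx f) := by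
  have h1 : ContDiffOn ℝ (⊤ : ℕ∞) (fun p : ℝ × ℝ =>
      fderivWithin ℝ (fun p : ℝ × ℝ => f p.1 p.2) (I ×ˢ univ) p (0, 1)) (I ×ˢ univ) :=
    (ContDiffOn.fderivWithin h (hI.prod uniqueDiffOn_univ) (by simp)).clm_apply
      contDiffOn_const
  refine h1.congr ?_
  rintro ⟨t, x⟩ ⟨ht, -⟩
  exact (h.hasDerivAt_fderivWithin ht x).deriv

lemma Sm.hasDerivAt_fderiv (h : Sm I f) (hI : IsOpen I) (ht : t ∈ I) (x : ℝ) :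
    HasDerivAt (fun s => f s x) (fderiv ℝ (fun p : ℝ × ℝ => f p.1 p.2) (t, x) (1, 0)) t := by
  have h1 := ((ContDiffOn.differentiableOn h (by simp)) (t, x)
    ⟨ht, mem_univ _⟩).differentiableAt ((hI.prod isOpen_univ).mem_nhds ⟨ht, mem_univ _⟩)
    |>.hasFDerivAt
  have h2 : HasDerivAt (fun s : ℝ => (s, x)) ((1 : ℝ), (0 : ℝ)) t :=
    (hasDerivAt_id t).prodMk (hasDerivAt_const t x)
  exact h1.comp_hasDerivAt t h2

lemma Sm.hasDerivAt_dt (h : Sm I f) (hI : IsOpen I) (ht : t ∈ I) (x : ℝ) :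
    HasDerivAt (fun s => f s x) (dt f t x) t :=
  (h.hasDerivAt_fderiv hI ht x).differentiableAt.hasDerivAt

lemma Sm.dt (h : Sm I f) (hI : IsOpen I) : Sm I (dt f) := by
  have h1 : ContDiffOn ℝ (⊤ : ℕ∞) (fun p : ℝ × ℝ =>
      fderiv ℝ (fun p : ℝ × ℝ => f p.1 p.2) p (1, 0)) (I ×ˢ univ) :=
    (ContDiffOn.fderiv_of_isOpen h (hI.prod isOpen_univ) (by simp)).clm_apply
      contDiffOn_const
  refine h1.congr ?_
  rintro ⟨t, x⟩ ⟨ht, -⟩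
  exact (h.hasDerivAt_fderiv hI ht x).deriv

lemma hasDerivAt_comp_apply {G : ℝ × ℝ → (ℝ × ℝ →L[ℝ] ℝ)}
    {G' : ℝ × ℝ →L[ℝ] (ℝ × ℝ →L[ℝ] ℝ)} {k : ℝ → ℝ × ℝ} {v w : ℝ × ℝ} {s : ℝ}
    (hG : HasFDerivAt G G' (k s)) (hk : HasDerivAt k v s) :
    HasDerivAt (fun r => G (k r) w) (G' v w) s := by
  have h1 : HasDerivAt (fun r => G (k r)) (G' v) s := hG.comp_hasDerivAt s hk
  simpa using h1.clm_apply (hasDerivAt_const s w)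

lemma Sm.dt_dx (h : Sm I f) (hI : IsOpen I) (ht : t ∈ I) (x : ℝ) :
    NSK.dt (NSK.dx f) t x = NSK.dx (NSK.dt f) t x := by
  set F : ℝ × ℝ → ℝ := fun p => f p.1 p.2 with hF
  have hO : IsOpen (I ×ˢ (univ : Set ℝ)) := hI.prod isOpen_univ
  have hD : ∀ s ∈ I, ∀ y, HasFDerivAt F (fderiv ℝ F (s, y)) (s, y) := fun s hs y =>
    (((ContDiffOn.differentiableOn h (by simp)) (s, y)
      ⟨hs, mem_univ _⟩).differentiableAt (hO.mem_nhds ⟨hs, mem_univ _⟩)).hasFDerivAt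
  have hD2 : HasFDerivAt (fderiv ℝ F) (fderiv ℝ (fderiv ℝ F) (t, x)) (t, x) := by
    have h1 : ContDiffOn ℝ 1 (fderiv ℝ F) (I ×ˢ univ) :=
      ContDiffOn.fderiv_of_isOpen h hO (by norm_cast)
    exact ((h1.differentiableOn (by simp) (t, x) ⟨ht, mem_univ _⟩).differentiableAt
      (hO.mem_nhds ⟨ht, mem_univ _⟩)).hasFDerivAt
  have hsymm := second_derivative_symmetric_of_eventually (f := F) (x := (t, x))
    (by filter_upwards [hO.mem_nhds ⟨ht, mem_univ _⟩] with p hp using hD p.1 hp.1 p.2) hD2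
    (1, 0) (0, 1)
  have e1 : NSK.dt (NSK.dx f) t x = fderiv ℝ (fderiv ℝ F) (t, x) (1, 0) (0, 1) := by
    have h2 : HasDerivAt (fun s : ℝ => (s, x)) ((1 : ℝ), (0 : ℝ)) t :=
      (hasDerivAt_id t).prodMk (hasDerivAt_const t x)
    have h3 := hasDerivAt_comp_apply (k := fun s : ℝ => (s, x)) (w := (0, 1)) hD2 h2
    have h4 : HasDerivAt (fun s => NSK.dx f s x)
        (fderiv ℝ (fderiv ℝ F) (t, x) (1, 0) (0, 1)) t := by
      refine h3.congr_of_eventuallyEq ?_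
      filter_upwards [hI.mem_nhds ht] with s hs
      have h5 : HasDerivAt (fun y : ℝ => (s, y)) ((0 : ℝ), (1 : ℝ)) x :=
        (hasDerivAt_const x s).prodMk (hasDerivAt_id x)
      exact ((hD s hs x).comp_hasDerivAt x h5).deriv
    exact h4.deriv
  have e2 : NSK.dx (NSK.dt f) t x = fderiv ℝ (fderiv ℝ F) (t, x) (0, 1) (1, 0) := by
    have h2 : HasDerivAt (fun y : ℝ => (t, y)) ((0 : ℝ), (1 : ℝ)) x :=
      (hasDerivAt_const x t).prodMk (hasDerivAt_id x)
    have h3 := hasDerivAt_comp_apply (k := fun y : ℝ => (t, y)) (w := (1, 0)) hD2 h2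
    have h4 : HasDerivAt (NSK.dt f t)
        (fderiv ℝ (fderiv ℝ F) (t, x) (0, 1) (1, 0)) x := by
      refine h3.congr_of_eventuallyEq ?_
      filter_upwards with y
      exact (h.hasDerivAt_fderiv hI ht y).deriv
    exact h4.deriv
  rw [e1, e2, hsymm]

lemma Ct.continuousOn_integral (h : Ct I f) : ContinuousOn (fun t => ∫ x in (0:ℝ)..1, f t x) I := by
  rw [continuousOn_iff_continuous_domRestrict]
  have h1 : Continuous (Function.uncurry fun (s : I) (x : ℝ) => f s x) := by
    have h2 : Continuous fun p : I × ℝ => ((p.1 : ℝ), p.2) := by fun_prop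
    exact ContinuousOn.comp_continuous h h2 fun p => ⟨p.1.2, mem_univ _⟩
  exact intervalIntegral.continuous_parametric_intervalIntegral_of_continuous' h1 0 1

lemma hasDerivAt_integral {f' : ℝ → ℝ → ℝ} (hI : IsOpen I) (h : Ct I f) (h' : Ct I f')
    (hd : ∀ t ∈ I, ∀ x, HasDerivAt (fun s => f s x) (f' t x) t) (ht : t ∈ I) :
    HasDerivAt (fun s => ∫ x in (0:ℝ)..1, f s x) (∫ x in (0:ℝ)..1, f' t x) t := by
  obtain ⟨K, hKt, hKI, hKc⟩ := local_compact_nhds (hI.mem_nhds ht)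
  obtain ⟨B, hB⟩ := (hKc.prod (isCompact_Icc (a := (0:ℝ)) (b := 1))).exists_bound_of_continuousOn
    (f := fun p : ℝ × ℝ => f' p.1 p.2) (ContinuousOn.mono h' (prod_mono hKI (subset_univ _)))
  refine (intervalIntegral.hasDerivAt_integral_of_dominated_loc_of_deriv_le
    (bound := fun _ => B) hKt ?_ ?_ ?_ ?_ ?_ ?_).2
  · filter_upwards [hI.mem_nhds ht] with s hs using (h.continuous hs).aestronglyMeasurable
  · exact (h.continuous ht).intervalIntegrable _ _
  · exact (h'.continuous ht).aestronglyMeasurable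
  · refine Eventually.of_forall fun x hx s hs => hB (s, x) ⟨hs, ?_⟩
    rw [uIoc_of_le zero_le_one] at hx
    exact ⟨hx.1.le, hx.2⟩
  · exact intervalIntegrable_const
  · exact Eventually.of_forall fun x _ s hs => hd s (hKI hs) x

lemma integral_eq_of_flux {g q Φ : ℝ → ℝ} (hg : Continuous g) (hq : Continuous q)
    (hΦ : ∀ x, HasDerivAt Φ (g x - q x) x) (hper : Φ 1 = Φ 0) :
    ∫ x in (0:ℝ)..1, g x = ∫ x in (0:ℝ)..1, q x := by
  have h1 := intervalIntegral.integral_eq_sub_of_hasDerivAt (a := 0) (b := 1)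
    (fun x _ => hΦ x) ((hg.sub hq).intervalIntegrable _ _)
  rw [intervalIntegral.integral_sub (hg.intervalIntegrable _ _) (hq.intervalIntegrable _ _),
    hper] at h1
  linarith

lemma integral_le {g q : ℝ → ℝ} (hg : Continuous g) (hq : Continuous q)
    (h : ∀ x ∈ Icc (0:ℝ) 1, g x ≤ q x) : ∫ x in (0:ℝ)..1, g x ≤ ∫ x in (0:ℝ)..1, q x :=
  intervalIntegral.integral_mono_on zero_le_one (hg.intervalIntegrable _ _)
    (hq.intervalIntegrable _ _) h

lemma integral_nonneg' {g : ℝ → ℝ} (h : ∀ x, 0 ≤ g x) : 0 ≤ ∫ x in (0:ℝ)..1, g x :=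
  intervalIntegral.integral_nonneg zero_le_one fun x _ => h x

lemma abs_sub_le_integral {g g' : ℝ → ℝ} (hg : ∀ x, HasDerivAt g (g' x) x) (hg' : Continuous g')
    {x y : ℝ} (hx : x ∈ Icc (0:ℝ) 1) (hy : y ∈ Icc (0:ℝ) 1) :
    |g x - g y| ≤ ∫ z in (0:ℝ)..1, |g' z| := by
  wlog hxy : y ≤ x generalizing x y
  · rw [abs_sub_comm]; exact this hy hx (le_of_not_ge hxy)
  rw [← intervalIntegral.integral_eq_sub_of_hasDerivAt (a := y) (b := x) (fun z _ => hg z)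
    (hg'.intervalIntegrable _ _)]
  refine (intervalIntegral.abs_integral_le_integral_abs hxy).trans ?_
  exact intervalIntegral.integral_mono_interval hy.1 hxy hx.2
    (Eventually.of_forall fun z => abs_nonneg _) (hg'.abs.intervalIntegrable _ _)

lemma abs_sub_mean_le {g g' : ℝ → ℝ} (hg : ∀ x, HasDerivAt g (g' x) x) (hg' : Continuous g')
    {x : ℝ} (hx : x ∈ Icc (0:ℝ) 1) :
    |g x - ∫ y in (0:ℝ)..1, g y| ≤ ∫ z in (0:ℝ)..1, |g' z| := by
  have hc : Continuous g := continuous_iff_continuousAt.2 fun x => (hg x).continuousAt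
  have h1 : g x - ∫ y in (0:ℝ)..1, g y = ∫ y in (0:ℝ)..1, (g x - g y) := by
    rw [intervalIntegral.integral_sub intervalIntegrable_const (hc.intervalIntegrable _ _)]
    simp
  rw [h1]
  refine (intervalIntegral.abs_integral_le_integral_abs zero_le_one).trans ?_
  refine (integral_le (by fun_prop) continuous_const
    fun y hy => abs_sub_le_integral hg hg' hx hy).trans ?_
  simp

lemma le_initial_of_deriv_nonpos {g : ℝ → ℝ} (hg : ContinuousOn g (Ico 0 T))
    (hd : ∀ t ∈ Ioo 0 T, ∃ g', HasDerivAt g g' t ∧ g' ≤ 0) (ht : t ∈ Ico 0 T) : g t ≤ g 0 := by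
  have hanti : AntitoneOn g (Ico 0 T) := by
    refine antitoneOn_of_deriv_nonpos (convex_Ico _ _) hg ?_ ?_
    · rw [interior_Ico]
      intro s hs
      obtain ⟨g', h, -⟩ := hd s hs
      exact h.differentiableAt.differentiableWithinAt
    · rw [interior_Ico]
      intro s hs
      obtain ⟨g', h, h'⟩ := hd s hs
      rw [h.deriv]
      exact h'
  exact hanti ⟨le_rfl, ht.1.trans_lt ht.2⟩ ht ht.1

/-- A Gronwall inequality with a coefficient controlled by the dissipation of an energy. -/
lemma gronwall_of_dissipation {y E d : ℝ → ℝ} {K L μ : ℝ} (hμ : 0 < μ) (hL : 0 ≤ L) (hK : 0 ≤ K)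
    (hy : ContinuousOn y (Ico 0 T)) (hE : ContinuousOn E (Ico 0 T))
    (hy0 : ∀ t ∈ Ico 0 T, 0 ≤ y t) (hE0 : ∀ t ∈ Ico 0 T, 0 ≤ E t)
    (hEd : ∀ t ∈ Ioo 0 T, HasDerivAt E (-(μ * d t)) t)
    (hyd : ∀ t ∈ Ioo 0 T, ∃ y', HasDerivAt y y' t ∧ y' ≤ (K + L * d t) * (1 + y t))
    (ht : t ∈ Ico 0 T) :
    y t ≤ (1 + y 0) * Real.exp (L / μ * E 0 + K * T) := by
  have hT : (0:ℝ) ∈ Ico 0 T := ⟨le_rfl, ht.1.trans_lt ht.2⟩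
  have hder : ∀ s ∈ Ioo 0 T, ∃ g', HasDerivAt
      (fun s => Real.log (1 + y s) + L / μ * E s - K * s) g' s ∧ g' ≤ 0 := by
    intro s hs
    obtain ⟨y', h1, h2⟩ := hyd s hs
    have hp : 0 < 1 + y s := by linarith [hy0 s (Ioo_subset_Ico_self hs)]
    refine ⟨_, (((h1.const_add 1).log hp.ne').add ((hEd s hs).const_mul (L / μ))).sub
      ((hasDerivAt_id s).const_mul K), ?_⟩
    have h3 : y' / (1 + y s) ≤ K + L * d s := by rwa [div_le_iff₀ hp]
    have h4 : L / μ * -(μ * d s) = - (L * d s) := by field_simp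
    rw [h4]; linarith
  have h := le_initial_of_deriv_nonpos (g := fun s => Real.log (1 + y s) + L / μ * E s - K * s)
    (((ContinuousOn.log (by fun_prop) fun s hs => by linarith [hy0 s hs]).add
      (by fun_prop)).sub (by fun_prop)) hder ht
  simp only [mul_zero, sub_zero] at h
  have h5 : 0 ≤ L / μ * E t := mul_nonneg (div_nonneg hL hμ.le) (hE0 t ht)
  have h6 : K * t ≤ K * T := mul_le_mul_of_nonneg_left ht.2.le hK
  have hp : 0 < 1 + y t := by linarith [hy0 t ht]
  have hp0 : 0 < 1 + y 0 := by linarith [hy0 0 hT]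
  have h7 : Real.log (1 + y t) ≤ Real.log (1 + y 0) + (L / μ * E 0 + K * T) := by linarith
  rw [Real.log_le_iff_le_exp hp, Real.exp_add, Real.exp_log hp0] at h7
  linarith

end Calculus

/-- A smooth periodic flow of the system on `[0,T)`, in the non-conservative form that the
estimates use, with the pressure expressed through its potential `W`. -/
structure Flow (μ κ γ T : ℝ) (W : ℝ → ℝ) (ρ u c : ℝ → ℝ → ℝ) : Prop where
  smooth_rho : Sm (Ico 0 T) ρ
  smooth_u : Sm (Ico 0 T) u
  smooth_c : Sm (Ico 0 T) c
  per_rho : ∀ t x, ρ t (x + 1) = ρ t x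
  per_u : ∀ t x, u t (x + 1) = u t x
  per_c : ∀ t x, c t (x + 1) = c t x
  pos : ∀ t x, 0 < ρ t x
  mass : ∀ t ∈ Ioo 0 T, ∀ x, dt ρ t x = -(dx ρ t x * u t x + ρ t x * dx u t x)
  momentum : ∀ t ∈ Ioo 0 T, ∀ x, ρ t x * dt u t x + ρ t x * u t x * dx u t x
    + deriv (deriv W) (ρ t x) * ρ t x * dx ρ t x
    = μ * dx (dx u) t x + γ * ρ t x * (dx c t x - dx ρ t x)
  elliptic : ∀ t ∈ Ico 0 T, ∀ x, κ * dx (dx c) t x = γ * (c t x - ρ t x)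
  potential_nonneg : ∀ r, 0 < r → 0 ≤ W r
  potential_deriv : ∀ r, 0 < r → HasDerivAt W (deriv W r) r
  potential_deriv2 : ∀ r, 0 < r → HasDerivAt (deriv W) (deriv (deriv W) r) r
  potential_cont : ContinuousOn (deriv (deriv W)) (Ioi 0)
  monotone : ∀ r, 0 < r → 0 ≤ deriv (deriv W) r + γ

lemma dx_periodic {f : ℝ → ℝ → ℝ} (h : ∀ t x, f t (x + 1) = f t x) (t x : ℝ) :
    dx f t (x + 1) = dx f t x := by
  have h1 : (fun y => f t (y + 1)) = f t := funext (h t)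
  unfold dx
  rw [← deriv_comp_add_const, h1]

lemma dt_periodic {f : ℝ → ℝ → ℝ} (h : ∀ t x, f t (x + 1) = f t x) (t x : ℝ) :
    dt f t (x + 1) = dt f t x := by
  unfold dt
  simp only [h]

lemma eq_zero_one_of_periodic {f : ℝ → ℝ → ℝ} (h : ∀ t x, f t (x + 1) = f t x) (t : ℝ) :
    f t 1 = f t 0 := by
  simpa using h t 0

/-- Composition of a function on the positive half-line with a positive density. -/
lemma Ct.comp_pos {I : Set ℝ} {ρ : ℝ → ℝ → ℝ} {g : ℝ → ℝ} (hρ : Ct I ρ) (hp : ∀ t x, 0 < ρ t x)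
    (hg : ContinuousOn g (Ioi 0)) : Ct I fun t x => g (ρ t x) :=
  ContinuousOn.comp (g := g) (f := fun p : ℝ × ℝ => ρ p.1 p.2) hg hρ fun p _ => hp p.1 p.2

namespace Flow

variable {μ κ γ T : ℝ} {W : ℝ → ℝ} {ρ u c : ℝ → ℝ → ℝ} {t : ℝ}

/-- The energy density. -/
noncomputable def energyDensity (κ γ : ℝ) (W : ℝ → ℝ) (ρ u c : ℝ → ℝ → ℝ) (t x : ℝ) : ℝ :=
  1 / 2 * ρ t x * u t x ^ 2 + W (ρ t x) + γ / 2 * (c t x - ρ t x) ^ 2 + κ / 2 * dx c t x ^ 2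

/-- The total energy. -/
noncomputable def energy (κ γ : ℝ) (W : ℝ → ℝ) (ρ u c : ℝ → ℝ → ℝ) (t : ℝ) : ℝ :=
  ∫ x in (0:ℝ)..1, energyDensity κ γ W ρ u c t x

/-- The effective velocity `u + μ ρ_x / ρ²`. -/
noncomputable def effVel (μ : ℝ) (ρ u : ℝ → ℝ → ℝ) (t x : ℝ) : ℝ :=
  u t x + μ * dx ρ t x / ρ t x ^ 2

/-- The density of the Bresch–Desjardins entropy. -/
noncomputable def entropyDensity (μ γ : ℝ) (W : ℝ → ℝ) (ρ u : ℝ → ℝ → ℝ) (t x : ℝ) : ℝ :=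
  1 / 2 * ρ t x * effVel μ ρ u t x ^ 2 + W (ρ t x) + γ / 2 * ρ t x ^ 2

/-- The Bresch–Desjardins entropy. -/
noncomputable def entropy (μ γ : ℝ) (W : ℝ → ℝ) (ρ u : ℝ → ℝ → ℝ) (t : ℝ) : ℝ :=
  ∫ x in (0:ℝ)..1, entropyDensity μ γ W ρ u t x

lemma continuousOn_potential (F : Flow μ κ γ T W ρ u c) : ContinuousOn W (Ioi 0) := fun r hr =>
  (F.potential_deriv r hr).continuousAt.continuousWithinAt

lemma continuousOn_deriv_potential (F : Flow μ κ γ T W ρ u c) :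
    ContinuousOn (deriv W) (Ioi 0) := fun r hr =>
  (F.potential_deriv2 r hr).continuousAt.continuousWithinAt

lemma ct_energyDensity (F : Flow μ κ γ T W ρ u c) : Ct (Ico 0 T) (energyDensity κ γ W ρ u c) := by
  have h1 : ContinuousOn _ _ := F.smooth_rho.ct
  have h2 : ContinuousOn _ _ := F.smooth_u.ct
  have h3 : ContinuousOn _ _ := F.smooth_c.ct
  have h4 : ContinuousOn _ _ := (F.smooth_c.dx (uniqueDiffOn_Ico _ _)).ct
  have h5 : ContinuousOn _ _ := F.smooth_rho.ct.comp_pos F.pos F.continuousOn_potential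
  unfold Ct energyDensity
  refine ((ContinuousOn.add ?_ h5).add ?_).add ?_ <;> fun_prop

lemma ct_effVel (F : Flow μ κ γ T W ρ u c) : Ct (Ico 0 T) (effVel μ ρ u) := by
  have h1 : ContinuousOn _ _ := F.smooth_rho.ct
  have h2 : ContinuousOn _ _ := F.smooth_u.ct
  have h4 : ContinuousOn _ _ := (F.smooth_rho.dx (uniqueDiffOn_Ico _ _)).ct
  unfold Ct effVel
  exact h2.add ((h4.const_mul μ).div (h1.pow 2) fun p _ => (pow_pos (F.pos _ _) 2).ne')

lemma ct_entropyDensity (F : Flow μ κ γ T W ρ u c) : Ct (Ico 0 T) (entropyDensity μ γ W ρ u) := by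
  have h1 : ContinuousOn _ _ := F.smooth_rho.ct
  have h2 : ContinuousOn _ _ := F.ct_effVel
  have h5 : ContinuousOn _ _ := F.smooth_rho.ct.comp_pos F.pos F.continuousOn_potential
  unfold Ct entropyDensity
  refine (ContinuousOn.add ?_ h5).add ?_ <;> fun_prop

lemma energyDensity_nonneg (F : Flow μ κ γ T W ρ u c) (hκ : 0 < κ) (hγ : 0 < γ) (t x : ℝ) :
    0 ≤ energyDensity κ γ W ρ u c t x := by
  have h1 := F.pos t x
  have h2 := F.potential_nonneg _ h1
  unfold energyDensity
  positivity

lemma hasDerivAt_energy (F : Flow μ κ γ T W ρ u c) (ht : t ∈ Ioo 0 T) :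
    HasDerivAt (energy κ γ W ρ u c) (-(μ * ∫ x in (0:ℝ)..1, dx u t x ^ 2)) t := by
  have hI : IsOpen (Ioo 0 T) := isOpen_Ioo
  have hU := hI.uniqueDiffOn (𝕜 := ℝ)
  have sρ := F.smooth_rho.mono Ioo_subset_Ico_self
  have su := F.smooth_u.mono Ioo_subset_Ico_self
  have sc := F.smooth_c.mono Ioo_subset_Ico_self
  have cρ : ContinuousOn _ _ := sρ.ct
  have cu : ContinuousOn _ _ := su.ct
  have cc : ContinuousOn _ _ := sc.ct
  have ccx : ContinuousOn _ _ := (sc.dx hU).ct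
  have cρt : ContinuousOn _ _ := (sρ.dt hI).ct
  have cut : ContinuousOn _ _ := (su.dt hI).ct
  have cct : ContinuousOn _ _ := (sc.dt hI).ct
  have ccxt : ContinuousOn _ _ := ((sc.dx hU).dt hI).ct
  have cW : ContinuousOn _ _ := sρ.ct.comp_pos F.pos F.continuousOn_deriv_potential
  set e' : ℝ → ℝ → ℝ := fun t x => 1 / 2 * dt ρ t x * u t x ^ 2 + ρ t x * u t x * dt u t x
    + deriv W (ρ t x) * dt ρ t x + γ * (c t x - ρ t x) * (dt c t x - dt ρ t x)
    + κ * dx c t x * dt (dx c) t x with he'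
  have ce' : Ct (Ioo 0 T) e' := by
    unfold Ct
    simp only [he']
    fun_prop
  have hd := hasDerivAt_integral hI (F.ct_energyDensity.mono Ioo_subset_Ico_self) ce' ?_ ht
  · refine hd.congr_deriv ?_
    have hq : Continuous (dx u t) := (su.dx hU).ct.continuous ht
    have key := integral_eq_of_flux (g := e' t) (q := fun x => -(μ * dx u t x ^ 2))
      (Φ := fun x => -(1 / 2 * (ρ t x * u t x ^ 3)) - deriv W (ρ t x) * (ρ t x * u t x)
        + μ * (u t x * dx u t x) + γ * ((c t x - ρ t x) * (ρ t x * u t x))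
        + κ * (dx c t x * dt c t x)) (ce'.continuous ht) (by fun_prop) ?_ ?_
    · rw [key, intervalIntegral.integral_neg, intervalIntegral.integral_const_mul]
    · intro x
      have dρ := sρ.hasDerivAt_dx ht x
      have du := su.hasDerivAt_dx ht x
      have dc := sc.hasDerivAt_dx ht x
      have dux := (su.dx hU).hasDerivAt_dx ht x
      have dcx := (sc.dx hU).hasDerivAt_dx ht x
      have dct := (sc.dt hI).hasDerivAt_dx ht x
      rw [← sc.dt_dx hI ht] at dct
      have dW := (F.potential_deriv2 _ (F.pos t x)).comp x dρ
      have hm := F.mass t ht x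
      have hmom := F.momentum t ht x
      have hell := F.elliptic t (Ioo_subset_Ico_self ht) x
      refine ((((((dρ.mul (du.pow 3)).const_mul (1 / 2)).neg.sub
        (dW.mul (dρ.mul du))).add ((du.mul dux).const_mul μ)).add
        (((dc.sub dρ).mul (dρ.mul du)).const_mul γ)).add
        ((dcx.mul dct).const_mul κ)).congr_deriv ?_
      simp only [he', Function.comp_apply, Pi.mul_apply, Pi.pow_apply, Pi.sub_apply]
      rw [hm]
      push_cast
      linear_combination (-u t x) * hmom + (dt c t x) * hell
    · simp only [eq_zero_one_of_periodic F.per_rho, eq_zero_one_of_periodic F.per_u,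
        eq_zero_one_of_periodic F.per_c, eq_zero_one_of_periodic (dx_periodic F.per_u),
        eq_zero_one_of_periodic (dx_periodic F.per_c),
        eq_zero_one_of_periodic (dt_periodic F.per_c)]
  · intro s hs x
    have dρ := sρ.hasDerivAt_dt hI hs x
    have du := su.hasDerivAt_dt hI hs x
    have dc := sc.hasDerivAt_dt hI hs x
    have dcx := (sc.dx hU).hasDerivAt_dt hI hs x
    have dW := (F.potential_deriv _ (F.pos s x)).comp s dρ
    refine (((((dρ.const_mul (1 / 2)).mul (du.pow 2)).add dW).add
      (((dc.sub dρ).pow 2).const_mul (γ / 2))).add ((dcx.pow 2).const_mul (κ / 2))).congr_deriv ?_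
    simp only [he', Pi.sub_apply, Pi.pow_apply]
    push_cast
    ring

end Flow

namespace Flow

variable {μ κ γ T : ℝ} {W : ℝ → ℝ} {ρ u c : ℝ → ℝ → ℝ} {t : ℝ}

/-- Half of the squared `L²` norm of the velocity gradient. -/
noncomputable def enstrophy (u : ℝ → ℝ → ℝ) (t : ℝ) : ℝ :=
  ∫ x in (0:ℝ)..1, 1 / 2 * dx u t x ^ 2

lemma integral_rho_eq (F : Flow μ κ γ T W ρ u c) (ht : t ∈ Ico 0 T) :
    ∫ x in (0:ℝ)..1, ρ t x = ∫ x in (0:ℝ)..1, ρ 0 x := by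
  have hI : IsOpen (Ioo 0 T) := isOpen_Ioo
  have sρ := F.smooth_rho.mono Ioo_subset_Ico_self
  have su := F.smooth_u.mono Ioo_subset_Ico_self
  have hd : ∀ s ∈ Ioo 0 T, HasDerivAt (fun s => ∫ x in (0:ℝ)..1, ρ s x) 0 s := by
    intro s hs
    have h1 := hasDerivAt_integral hI sρ.ct (sρ.dt hI).ct
      (fun s hs x => sρ.hasDerivAt_dt hI hs x) hs
    have h2 := integral_eq_of_flux (g := dt ρ s) (q := fun _ => 0)
      (Φ := fun x => -(ρ s x * u s x)) ((sρ.dt hI).ct.continuous hs) continuous_const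
      (fun x => (((sρ.hasDerivAt_dx hs x).mul (su.hasDerivAt_dx hs x)).neg).congr_deriv
        (by rw [F.mass s hs x]; ring))
      (by simp only [eq_zero_one_of_periodic F.per_rho, eq_zero_one_of_periodic F.per_u])
    rw [h2] at h1
    simpa using h1
  have hc : ContinuousOn (fun s => ∫ x in (0:ℝ)..1, ρ s x) (Ico 0 T) :=
    F.smooth_rho.ct.continuousOn_integral
  refine le_antisymm (le_initial_of_deriv_nonpos hc (fun s hs => ⟨0, hd s hs, le_rfl⟩) ht) ?_
  exact neg_le_neg_iff.1 (le_initial_of_deriv_nonpos hc.neg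
    (fun s hs => ⟨-0, (hd s hs).neg, by simp⟩) ht)

lemma energy_le (F : Flow μ κ γ T W ρ u c) (hμ : 0 < μ) (ht : t ∈ Ico 0 T) :
    energy κ γ W ρ u c t ≤ energy κ γ W ρ u c 0 :=
  le_initial_of_deriv_nonpos F.ct_energyDensity.continuousOn_integral
    (fun _ hs => ⟨_, F.hasDerivAt_energy hs, neg_nonpos.2
      (mul_nonneg hμ.le (integral_nonneg' fun _ => sq_nonneg _))⟩) ht

lemma dx_dt_rho (F : Flow μ κ γ T W ρ u c) (ht : t ∈ Ioo 0 T) (x : ℝ) : dt (dx ρ) t x =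
    -(dx (dx ρ) t x * u t x + 2 * (dx ρ t x * dx u t x) + ρ t x * dx (dx u) t x) := by
  have hI : IsOpen (Ioo 0 T) := isOpen_Ioo
  have hU := hI.uniqueDiffOn (𝕜 := ℝ)
  have sρ := F.smooth_rho.mono Ioo_subset_Ico_self
  have su := F.smooth_u.mono Ioo_subset_Ico_self
  rw [sρ.dt_dx hI ht]
  have h : dt ρ t = fun x => -(dx ρ t x * u t x + ρ t x * dx u t x) := funext (F.mass t ht)
  change deriv (dt ρ t) x = _
  rw [h]
  refine ((((sρ.dx hU).hasDerivAt_dx ht x).mul (su.hasDerivAt_dx ht x)).add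
    ((sρ.hasDerivAt_dx ht x).mul ((su.dx hU).hasDerivAt_dx ht x))).neg.deriv.trans ?_
  ring

lemma hasDerivAt_entropy (F : Flow μ κ γ T W ρ u c) (ht : t ∈ Ioo 0 T) :
    HasDerivAt (entropy μ γ W ρ u) (∫ x in (0:ℝ)..1,
      (γ * (ρ t x * dx c t x * effVel μ ρ u t x)
        - μ * (deriv (deriv W) (ρ t x) + γ) * dx ρ t x ^ 2 / ρ t x)) t := by
  have hI : IsOpen (Ioo 0 T) := isOpen_Ioo
  have hU := hI.uniqueDiffOn (𝕜 := ℝ)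
  have sρ := F.smooth_rho.mono Ioo_subset_Ico_self
  have su := F.smooth_u.mono Ioo_subset_Ico_self
  have sc := F.smooth_c.mono Ioo_subset_Ico_self
  have cρ : ContinuousOn _ _ := sρ.ct
  have cu : ContinuousOn _ _ := su.ct
  have cv : ContinuousOn _ _ := F.ct_effVel.mono Ioo_subset_Ico_self
  have cρx : ContinuousOn _ _ := (sρ.dx hU).ct
  have cρt : ContinuousOn _ _ := (sρ.dt hI).ct
  have cρxt : ContinuousOn _ _ := ((sρ.dx hU).dt hI).ct
  have cut : ContinuousOn _ _ := (su.dt hI).ct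
  have cW : ContinuousOn _ _ := sρ.ct.comp_pos F.pos F.continuousOn_deriv_potential
  set vt : ℝ → ℝ → ℝ := fun t x => dt u t x + (μ * dt (dx ρ) t x * ρ t x ^ 2
    - μ * dx ρ t x * (2 * ρ t x * dt ρ t x)) / (ρ t x ^ 2) ^ 2 with hvt
  have cvt : ContinuousOn (fun p : ℝ × ℝ => vt p.1 p.2) (Ioo 0 T ×ˢ univ) := by
    simp only [hvt]
    refine cut.add (ContinuousOn.div (by fun_prop) (by fun_prop) fun p _ => ?_)
    exact (pow_pos (pow_pos (F.pos _ _) 2) 2).ne'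
  set e' : ℝ → ℝ → ℝ := fun t x => 1 / 2 * dt ρ t x * effVel μ ρ u t x ^ 2
    + ρ t x * effVel μ ρ u t x * vt t x
    + deriv W (ρ t x) * dt ρ t x + γ * ρ t x * dt ρ t x with he'
  have ce' : Ct (Ioo 0 T) e' := by
    unfold Ct
    simp only [he']
    fun_prop
  have hd := hasDerivAt_integral hI (F.ct_entropyDensity.mono Ioo_subset_Ico_self) ce' ?_ ht
  · refine hd.congr_deriv ?_
    have qρ : Continuous (ρ t) := sρ.ct.continuous ht
    have qv : Continuous (effVel μ ρ u t) :=
      (F.ct_effVel.mono Ioo_subset_Ico_self).continuous ht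
    have qρx : Continuous (dx ρ t) := (sρ.dx hU).ct.continuous ht
    have qcx : Continuous (dx c t) := (sc.dx hU).ct.continuous ht
    have qW : Continuous fun x => deriv (deriv W) (ρ t x) :=
      F.potential_cont.comp_continuous qρ fun x => F.pos t x
    refine integral_eq_of_flux
      (Φ := fun x => -(1 / 2 * (ρ t x * u t x * effVel μ ρ u t x ^ 2))
        - (deriv W (ρ t x) + γ * ρ t x) * (ρ t x * u t x)) (ce'.continuous ht)
      (Continuous.sub (by fun_prop) (Continuous.div (by fun_prop) qρ fun x => (F.pos t x).ne'))
      ?_ ?_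
    · intro x
      have hp := (F.pos t x).ne'
      have dρ := sρ.hasDerivAt_dx ht x
      have du := su.hasDerivAt_dx ht x
      have dρx := (sρ.dx hU).hasDerivAt_dx ht x
      have dW := (F.potential_deriv2 _ (F.pos t x)).comp x dρ
      have dv : HasDerivAt (effVel μ ρ u t) _ x :=
        du.add ((dρx.const_mul μ).div (dρ.pow 2) (pow_ne_zero 2 hp))
      have hm := F.mass t ht x
      have hmom := F.momentum t ht x
      have hxt := F.dx_dt_rho ht x
      refine (((((dρ.mul du).mul (dv.pow 2)).const_mul (1 / 2)).neg).sub
        ((dW.add (dρ.const_mul γ)).mul (dρ.mul du))).congr_deriv ?_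
      simp only [he', hvt, Function.comp_apply, Pi.mul_apply, Pi.pow_apply,
        Pi.add_apply]
      rw [hm, hxt]
      unfold effVel
      push_cast
      field_simp
      linear_combination
        (-2 * (u t x * ρ t x ^ 2 + μ * dx ρ t x)) * ρ t x ^ 2 * hmom
    · have hv : ∀ t x, effVel μ ρ u t (x + 1) = effVel μ ρ u t x := fun t x => by
        unfold effVel
        rw [F.per_rho, F.per_u, dx_periodic F.per_rho]
      simp only [eq_zero_one_of_periodic F.per_rho, eq_zero_one_of_periodic F.per_u,
        eq_zero_one_of_periodic hv]
  · intro s hs x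
    have hp := (F.pos s x).ne'
    have dρ := sρ.hasDerivAt_dt hI hs x
    have du := su.hasDerivAt_dt hI hs x
    have dρx := (sρ.dx hU).hasDerivAt_dt hI hs x
    have dW := (F.potential_deriv _ (F.pos s x)).comp s dρ
    have dv : HasDerivAt (fun s => effVel μ ρ u s x) (vt s x) s :=
      (du.add ((dρx.const_mul μ).div (dρ.pow 2) (pow_ne_zero 2 hp))).congr_deriv (by
        simp only [hvt, Pi.pow_apply]
        push_cast
        ring)
    refine ((((dρ.const_mul (1 / 2)).mul (dv.pow 2)).add dW).add
      ((dρ.pow 2).const_mul (γ / 2))).congr_deriv ?_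
    simp only [he', Pi.pow_apply]
    push_cast
    ring

lemma hasDerivAt_enstrophy (F : Flow μ κ γ T W ρ u c) (ht : t ∈ Ioo 0 T) :
    HasDerivAt (enstrophy u) (∫ x in (0:ℝ)..1, -(dx (dx u) t x * dt u t x)) t := by
  have hI : IsOpen (Ioo 0 T) := isOpen_Ioo
  have hU := hI.uniqueDiffOn (𝕜 := ℝ)
  have su := F.smooth_u.mono Ioo_subset_Ico_self
  have cux : ContinuousOn _ _ := (su.dx hU).ct
  have cuxt : ContinuousOn _ _ := ((su.dx hU).dt hI).ct
  have ce' : Ct (Ioo 0 T) fun t x => dx u t x * dt (dx u) t x := ContinuousOn.mul cux cuxt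
  have ce : Ct (Ioo 0 T) fun t x => 1 / 2 * dx u t x ^ 2 := by
    unfold Ct
    fun_prop
  have hd := hasDerivAt_integral hI ce ce' (fun s hs x =>
    ((((su.dx hU).hasDerivAt_dt hI hs x).pow 2).const_mul (1 / 2)).congr_deriv (by
      push_cast; ring)) ht
  refine hd.congr_deriv ?_
  have q1 : Continuous (dx (dx u) t) := ((su.dx hU).dx hU).ct.continuous ht
  have q2 : Continuous (dt u t) := (su.dt hI).ct.continuous ht
  refine integral_eq_of_flux (Φ := fun x => dx u t x * dt u t x) (ce'.continuous ht)
    (by fun_prop) (fun x => ?_) ?_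
  · refine (((su.dx hU).hasDerivAt_dx ht x).mul ((su.dt hI).hasDerivAt_dx ht x)).congr_deriv ?_
    rw [su.dt_dx hI ht]
    ring
  · simp only [eq_zero_one_of_periodic (dx_periodic F.per_u),
      eq_zero_one_of_periodic (dt_periodic F.per_u)]

end Flow

lemma sq_le_of_hasDerivAt {g g' : ℝ → ℝ} (hg : ∀ x, HasDerivAt g (g' x) x) (hg' : Continuous g')
    {x : ℝ} (hx : x ∈ Icc (0:ℝ) 1) :
    g x ^ 2 ≤ 2 * (∫ y in (0:ℝ)..1, g y ^ 2) + ∫ y in (0:ℝ)..1, g' y ^ 2 := by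
  have hc : Continuous g := continuous_iff_continuousAt.2 fun x => (hg x).continuousAt
  have h1 := abs_sub_mean_le (g := fun x => g x ^ 2) (g' := fun x => 2 * g x * g' x)
    (fun x => ((hg x).pow 2).congr_deriv (by push_cast; ring)) (by fun_prop) hx
  have h2 : ∫ z in (0:ℝ)..1, |2 * g z * g' z| ≤ ∫ z in (0:ℝ)..1, (g z ^ 2 + g' z ^ 2) := by
    refine integral_le (by fun_prop) (by fun_prop) fun z _ => abs_le.2 ⟨?_, ?_⟩
    · nlinarith [sq_nonneg (g z + g' z)]
    · nlinarith [sq_nonneg (g z - g' z)]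
  have hi1 : IntervalIntegrable (fun z => g z ^ 2) volume 0 1 :=
    (hc.pow 2).intervalIntegrable _ _
  have hi2 : IntervalIntegrable (fun z => g' z ^ 2) volume 0 1 :=
    (hg'.pow 2).intervalIntegrable _ _
  rw [intervalIntegral.integral_add hi1 hi2] at h2
  linarith [(abs_le.1 h1).2]

/-- A positive function is comparable with its mean if its logarithm has small oscillation. -/
lemma mean_comparison {g g' : ℝ → ℝ} (hg : ∀ x, HasDerivAt g (g' x) x) (hg' : Continuous g')
    (hpos : ∀ x, 0 < g x) {L : ℝ} (hL : ∫ z in (0:ℝ)..1, |g' z / g z| ≤ L) {x : ℝ}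
    (hx : x ∈ Icc (0:ℝ) 1) :
    Real.exp (-L) * (∫ y in (0:ℝ)..1, g y) ≤ g x ∧ g x ≤ Real.exp L * ∫ y in (0:ℝ)..1, g y := by
  have hc : Continuous g := continuous_iff_continuousAt.2 fun x => (hg x).continuousAt
  have h1 : ∀ x ∈ Icc (0:ℝ) 1, ∀ y ∈ Icc (0:ℝ) 1, g x ≤ Real.exp L * g y := by
    intro x hx y hy
    have h2 := abs_sub_le_integral (g := fun x => Real.log (g x)) (g' := fun x => g' x / g x)
      (fun x => (hg x).log (hpos x).ne') (hg'.div hc fun x => (hpos x).ne') hx hy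
    have h3 : Real.log (g x) ≤ L + Real.log (g y) := by linarith [(abs_le.1 h2).2]
    rwa [Real.log_le_iff_le_exp (hpos x), Real.exp_add, Real.exp_log (hpos y)] at h3
  have h4 : (∫ y in (0:ℝ)..1, g y) ≤ Real.exp L * g x := by
    refine (integral_le hc continuous_const fun y hy => h1 y hy x hx).trans ?_
    simp
  constructor
  · calc Real.exp (-L) * (∫ y in (0:ℝ)..1, g y) ≤ Real.exp (-L) * (Real.exp L * g x) := by gcongr
      _ = g x := by rw [← mul_assoc, ← Real.exp_add]; simp
  · rw [← intervalIntegral.integral_const_mul]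
    refine le_trans ?_ (integral_le continuous_const (by fun_prop) fun y hy => h1 x hx y hy)
    simp

namespace Flow

variable {μ κ γ T : ℝ} {W : ℝ → ℝ} {ρ u c : ℝ → ℝ → ℝ} {t x E₀ B₁ : ℝ}

lemma energy_nonneg (F : Flow μ κ γ T W ρ u c)
    (hκ : 0 < κ) (hγ : 0 < γ) (t : ℝ) : 0 ≤ energy κ γ W ρ u c t :=
  integral_nonneg' fun x => F.energyDensity_nonneg hκ hγ t x

lemma entropyDensity_nonneg (F : Flow μ κ γ T W ρ u c)
    (hγ : 0 < γ) (t x : ℝ) : 0 ≤ entropyDensity μ γ W ρ u t x := by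
  have h1 := F.pos t x
  have h2 := F.potential_nonneg _ h1
  unfold entropyDensity
  positivity

lemma entropy_nonneg (F : Flow μ κ γ T W ρ u c) (hγ : 0 < γ) (t : ℝ) : 0 ≤ entropy μ γ W ρ u t :=
  integral_nonneg' fun x => F.entropyDensity_nonneg hγ t x

lemma abs_dx_c_le (F : Flow μ κ γ T W ρ u c)
    (hκ : 0 < κ) (hγ : 0 < γ) (hE : energy κ γ W ρ u c t ≤ E₀)
    (ht : t ∈ Ico 0 T) (hx : x ∈ Icc (0:ℝ) 1) : |dx c t x| ≤ γ / κ * (1 / 2 + E₀ / γ) := by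
  have hU := uniqueDiffOn_Ico (0:ℝ) T
  have scx := F.smooth_c.dx hU
  have cρ : Continuous (ρ t) := F.smooth_rho.ct.continuous ht
  have cc : Continuous (c t) := F.smooth_c.ct.continuous ht
  have ccx : Continuous (dx c t) := scx.ct.continuous ht
  have ccxx : Continuous (dx (dx c) t) := (scx.dx hU).ct.continuous ht
  have h0 : ∫ y in (0:ℝ)..1, dx c t y = 0 := by
    rw [intervalIntegral.integral_eq_sub_of_hasDerivAt
      (fun y _ => F.smooth_c.hasDerivAt_dx ht y) (ccx.intervalIntegrable _ _),
      eq_zero_one_of_periodic F.per_c, sub_self]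
  have h1 := abs_sub_mean_le (scx.hasDerivAt_dx ht) ccxx hx
  rw [h0, sub_zero] at h1
  have h2 : ∫ z in (0:ℝ)..1, |dx (dx c) t z| ≤
      ∫ z in (0:ℝ)..1, γ / κ * (1 / 2 + 1 / γ * energyDensity κ γ W ρ u c t z) := by
    have := F.ct_energyDensity.continuous ht
    refine integral_le (by fun_prop) (by fun_prop) fun z _ => ?_
    have e1 : dx (dx c) t z = γ / κ * (c t z - ρ t z) := by
      have := F.elliptic t ht z
      field_simp
      linarith
    rw [e1, abs_mul, abs_of_pos (div_pos hγ hκ)]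
    gcongr
    have h3 : 1 / γ * (γ / 2 * (c t z - ρ t z) ^ 2) ≤
        1 / γ * energyDensity κ γ W ρ u c t z := by
      have := F.pos t z
      have := F.potential_nonneg _ this
      refine mul_le_mul_of_nonneg_left ?_ (by positivity)
      have h4 : 0 ≤ 1 / 2 * ρ t z * u t z ^ 2 := by positivity
      have h5 : 0 ≤ κ / 2 * dx c t z ^ 2 := by positivity
      unfold energyDensity
      linarith
    have h4 : 1 / γ * (γ / 2 * (c t z - ρ t z) ^ 2) = 1 / 2 * (c t z - ρ t z) ^ 2 := by
      field_simp
    refine abs_le.2 ⟨?_, ?_⟩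
    · nlinarith [sq_nonneg (c t z - ρ t z + 1)]
    · nlinarith [sq_nonneg (c t z - ρ t z - 1)]
  refine h1.trans (h2.trans ?_)
  have hi : IntervalIntegrable (fun z => 1 / γ * energyDensity κ γ W ρ u c t z) volume 0 1 :=
    ((F.ct_energyDensity.continuous ht).const_mul _).intervalIntegrable _ _
  rw [intervalIntegral.integral_const_mul, intervalIntegral.integral_add
    intervalIntegrable_const hi, intervalIntegral.integral_const_mul]
  have h3 : 1 / γ * energy κ γ W ρ u c t ≤ E₀ / γ := by
    rw [one_div_mul_eq_div]
    gcongr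
  unfold energy at h3
  simp only [intervalIntegral.integral_const, sub_zero, one_smul]
  gcongr

lemma integral_dx_rho_le (F : Flow μ κ γ T W ρ u c) (hμ : 0 < μ) (hκ : 0 < κ) (hγ : 0 < γ)
    (hE : energy κ γ W ρ u c t ≤ E₀) (hB : entropy μ γ W ρ u t ≤ B₁) (ht : t ∈ Ico 0 T) :
    ∫ x in (0:ℝ)..1, dx ρ t x ^ 2 / ρ t x ^ 3 ≤ (4 * B₁ + 4 * E₀) / μ ^ 2 := by
  have cρ : Continuous (ρ t) := F.smooth_rho.ct.continuous ht
  have cρx : Continuous (dx ρ t) :=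
    (F.smooth_rho.dx (uniqueDiffOn_Ico _ _)).ct.continuous ht
  have ce := F.ct_energyDensity.continuous ht
  have cb := F.ct_entropyDensity.continuous ht
  have h1 : ∫ x in (0:ℝ)..1, dx ρ t x ^ 2 / ρ t x ^ 3 ≤ ∫ x in (0:ℝ)..1,
      1 / μ ^ 2 * (4 * entropyDensity μ γ W ρ u t x + 4 * energyDensity κ γ W ρ u c t x) := by
    refine integral_le ((cρx.pow 2).div (cρ.pow 3) fun x => (pow_pos (F.pos t x) 3).ne')
      (by fun_prop) fun x _ => ?_
    have hp := F.pos t x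
    have hW := F.potential_nonneg _ hp
    have e1 : dx ρ t x ^ 2 / ρ t x ^ 3 =
        1 / μ ^ 2 * (ρ t x * (effVel μ ρ u t x - u t x) ^ 2) := by
      unfold effVel
      field_simp
      ring
    rw [e1]
    refine mul_le_mul_of_nonneg_left ?_ (by positivity)
    have h2 : 0 ≤ γ / 2 * ρ t x ^ 2 := by positivity
    have h3 : 0 ≤ γ / 2 * (c t x - ρ t x) ^ 2 := by positivity
    have h4 : 0 ≤ κ / 2 * dx c t x ^ 2 := by positivity
    have h5 := mul_nonneg hp.le (sq_nonneg (effVel μ ρ u t x + u t x))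
    unfold entropyDensity energyDensity
    nlinarith
  refine h1.trans ?_
  have hi1 : IntervalIntegrable (fun x => 4 * entropyDensity μ γ W ρ u t x) volume 0 1 :=
    (cb.const_mul _).intervalIntegrable _ _
  have hi2 : IntervalIntegrable (fun x => 4 * energyDensity κ γ W ρ u c t x) volume 0 1 :=
    (ce.const_mul _).intervalIntegrable _ _
  rw [intervalIntegral.integral_const_mul, intervalIntegral.integral_add hi1 hi2,
    intervalIntegral.integral_const_mul, intervalIntegral.integral_const_mul, one_div_mul_eq_div]
  unfold energy at hE
  unfold entropy at hB
  gcongr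

lemma density_bounds (F : Flow μ κ γ T W ρ u c)
    {M D : ℝ} (hD : ∫ x in (0:ℝ)..1, dx ρ t x ^ 2 / ρ t x ^ 3 ≤ D)
    (hm : ∫ x in (0:ℝ)..1, ρ t x ≤ M) (hm' : M⁻¹ ≤ ∫ x in (0:ℝ)..1, ρ t x)
    (ht : t ∈ Ico 0 T) (hx : x ∈ Icc (0:ℝ) 1) :
    Real.exp (-((D + M) / 2)) * M⁻¹ ≤ ρ t x ∧ ρ t x ≤ Real.exp ((D + M) / 2) * M := by
  have cρ : Continuous (ρ t) := F.smooth_rho.ct.continuous ht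
  have cρx : Continuous (dx ρ t) :=
    (F.smooth_rho.dx (uniqueDiffOn_Ico _ _)).ct.continuous ht
  have c3 : Continuous fun x => dx ρ t x ^ 2 / ρ t x ^ 3 :=
    (cρx.pow 2).div (cρ.pow 3) fun x => (pow_pos (F.pos t x) 3).ne'
  have hL : ∫ z in (0:ℝ)..1, |dx ρ t z / ρ t z| ≤ (D + M) / 2 := by
    have h1 : ∫ z in (0:ℝ)..1, |dx ρ t z / ρ t z| ≤
        ∫ z in (0:ℝ)..1, 1 / 2 * (dx ρ t z ^ 2 / ρ t z ^ 3 + ρ t z) := by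
      refine integral_le (cρx.div cρ fun x => (F.pos t x).ne').abs (by fun_prop) fun z _ => ?_
      have hp := F.pos t z
      have key : ∀ s : ℝ, s ≤ 1 / 2 * (s ^ 2 / ρ t z + ρ t z) := by
        intro s
        have e : 1 / 2 * (s ^ 2 / ρ t z + ρ t z) - s = (s - ρ t z) ^ 2 / (2 * ρ t z) := by
          field_simp
          ring
        have : 0 ≤ (s - ρ t z) ^ 2 / (2 * ρ t z) := by positivity
        linarith
      have h2 := key |dx ρ t z / ρ t z|
      have e2 : |dx ρ t z / ρ t z| ^ 2 / ρ t z = dx ρ t z ^ 2 / ρ t z ^ 3 := by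
        rw [sq_abs]
        field_simp
      rwa [e2] at h2
    refine h1.trans ?_
    rw [intervalIntegral.integral_const_mul, intervalIntegral.integral_add
      (c3.intervalIntegrable _ _) (cρ.intervalIntegrable _ _)]
    linarith
  have h := mean_comparison (F.smooth_rho.hasDerivAt_dx ht) cρx (F.pos t) hL hx
  exact ⟨le_trans (by gcongr) h.1, h.2.trans (by gcongr)⟩

lemma entropy_le (F : Flow μ κ γ T W ρ u c)
    {A M : ℝ} (hμ : 0 < μ) (hγ : 0 < γ) (hA0 : 0 ≤ A) (hM : 0 ≤ M)
    (hA : ∀ t ∈ Ioo 0 T, ∀ x ∈ Icc (0:ℝ) 1, |dx c t x| ≤ A)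
    (hm : ∀ t ∈ Ioo 0 T, ∫ x in (0:ℝ)..1, ρ t x ≤ M) (ht : t ∈ Ico 0 T) :
    entropy μ γ W ρ u t ≤
      (1 + entropy μ γ W ρ u 0) * Real.exp (γ * A * (M / 2 + 1) * T) := by
  have h := gronwall_of_dissipation (y := entropy μ γ W ρ u) (E := fun _ => 0) (d := fun _ => 0)
    (K := γ * A * (M / 2 + 1)) (L := 0) hμ le_rfl (by positivity)
    F.ct_entropyDensity.continuousOn_integral continuousOn_const
    (fun t _ => F.entropy_nonneg hγ t) (fun _ _ => le_rfl)
    (fun t _ => (hasDerivAt_const t (0:ℝ)).congr_deriv (by simp))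
    (fun s hs => ⟨_, F.hasDerivAt_entropy hs, ?_⟩) ht
  · simpa using h
  have hs' := Ioo_subset_Ico_self hs
  have hU := uniqueDiffOn_Ico (0:ℝ) T
  have cρ : Continuous (ρ s) := F.smooth_rho.ct.continuous hs'
  have cρx : Continuous (dx ρ s) := (F.smooth_rho.dx hU).ct.continuous hs'
  have ccx : Continuous (dx c s) := (F.smooth_c.dx hU).ct.continuous hs'
  have cv : Continuous (effVel μ ρ u s) := F.ct_effVel.continuous hs'
  have cb := F.ct_entropyDensity.continuous hs'
  have cW : Continuous fun x => deriv (deriv W) (ρ s x) :=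
    F.potential_cont.comp_continuous cρ fun x => F.pos s x
  have h1 : ∫ x in (0:ℝ)..1, (γ * (ρ s x * dx c s x * effVel μ ρ u s x)
        - μ * (deriv (deriv W) (ρ s x) + γ) * dx ρ s x ^ 2 / ρ s x) ≤
      ∫ x in (0:ℝ)..1, γ * A * (1 / 2 * ρ s x + entropyDensity μ γ W ρ u s x) := by
    refine integral_le (Continuous.sub (by fun_prop)
      (Continuous.div (by fun_prop) cρ fun x => (F.pos s x).ne')) (by fun_prop) fun x hx => ?_
    have hp := F.pos s x
    have hW := F.potential_nonneg _ hp
    have hmon := F.monotone _ hp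
    have h2 : 0 ≤ μ * (deriv (deriv W) (ρ s x) + γ) * dx ρ s x ^ 2 / ρ s x := by positivity
    have h3 : dx c s x * effVel μ ρ u s x ≤ A * (1 / 2 * (1 + effVel μ ρ u s x ^ 2)) := by
      refine (le_abs_self _).trans ?_
      rw [abs_mul]
      refine mul_le_mul (hA s hs x hx) ?_ (abs_nonneg _) hA0
      rw [← sq_abs (effVel μ ρ u s x)]
      nlinarith [sq_nonneg (|effVel μ ρ u s x| - 1)]
    have h4 : γ * (ρ s x * dx c s x * effVel μ ρ u s x) ≤
        γ * A * (1 / 2 * ρ s x + 1 / 2 * ρ s x * effVel μ ρ u s x ^ 2) := by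
      have := mul_le_mul_of_nonneg_left h3 (mul_nonneg hγ.le hp.le)
      linarith
    have h5 : 1 / 2 * ρ s x * effVel μ ρ u s x ^ 2 ≤ entropyDensity μ γ W ρ u s x := by
      have : 0 ≤ γ / 2 * ρ s x ^ 2 := by positivity
      unfold entropyDensity
      linarith
    have h6 : γ * A * (1 / 2 * ρ s x + 1 / 2 * ρ s x * effVel μ ρ u s x ^ 2) ≤
        γ * A * (1 / 2 * ρ s x + entropyDensity μ γ W ρ u s x) := by gcongr
    linarith
  refine h1.trans ?_
  have hi : IntervalIntegrable (fun x => 1 / 2 * ρ s x) volume 0 1 :=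
    (cρ.const_mul _).intervalIntegrable _ _
  rw [intervalIntegral.integral_const_mul, intervalIntegral.integral_add hi
    (cb.intervalIntegrable _ _), intervalIntegral.integral_const_mul]
  have hb := F.entropy_nonneg hγ s
  change _ * (_ + entropy μ γ W ρ u s) ≤ _
  rw [zero_mul, add_zero, mul_assoc _ (M / 2 + 1)]
  refine mul_le_mul_of_nonneg_left ?_ (by positivity)
  have := hm s hs
  nlinarith [mul_nonneg hM hb]

/-- Propagation of the gradient bound for the velocity, given uniform bounds on the density. -/
lemma enstrophy_le (F : Flow μ κ γ T W ρ u c)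
    {A K R D Q : ℝ} (hμ : 0 < μ) (hκ : 0 < κ) (hγ : 0 < γ) (hK : 0 ≤ K)
    (hR : 0 < R) (hD0 : 0 ≤ D)
    (hA : ∀ t ∈ Ioo 0 T, ∀ x ∈ Icc (0:ℝ) 1, |dx c t x| ≤ A)
    (hu : ∀ t ∈ Ioo 0 T, ∫ x in (0:ℝ)..1, u t x ^ 2 ≤ K)
    (hρ : ∀ t ∈ Ioo 0 T, ∀ x ∈ Icc (0:ℝ) 1, ρ t x ≤ R)
    (hρx : ∀ t ∈ Ioo 0 T, ∫ x in (0:ℝ)..1, dx ρ t x ^ 2 ≤ D)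
    (hQ : ∀ t ∈ Ioo 0 T, ∀ x ∈ Icc (0:ℝ) 1, |deriv (deriv W) (ρ t x) + γ| ≤ Q)
    (ht : t ∈ Ico 0 T) :
    enstrophy u t ≤ (1 + enstrophy u 0) * Real.exp (R / μ * 2 / μ * energy κ γ W ρ u c 0
      + R / μ * (4 * K + Q ^ 2 * D + γ ^ 2 * A ^ 2) * T) := by
  have hU := uniqueDiffOn_Ico (0:ℝ) T
  have cy : Ct (Ico 0 T) fun t x => 1 / 2 * dx u t x ^ 2 := by
    have h : ContinuousOn _ _ := (F.smooth_u.dx hU).ct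
    unfold Ct
    fun_prop
  have hy0 : ∀ s, 0 ≤ enstrophy u s := fun s => integral_nonneg' fun x => by positivity
  refine gronwall_of_dissipation (y := enstrophy u) (E := energy κ γ W ρ u c)
    (d := fun t => ∫ x in (0:ℝ)..1, dx u t x ^ 2)
    hμ (by positivity) (by positivity) cy.continuousOn_integral
    F.ct_energyDensity.continuousOn_integral (fun s _ => hy0 s)
    (fun s _ => F.energy_nonneg hκ hγ s) (fun s hs => F.hasDerivAt_energy hs)
    (fun s hs => ⟨_, F.hasDerivAt_enstrophy hs, ?_⟩) ht
  have hs' := Ioo_subset_Ico_self hs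
  have cux : Continuous (dx u s) := (F.smooth_u.dx hU).ct.continuous hs'
  have cuxx : Continuous (dx (dx u) s) := ((F.smooth_u.dx hU).dx hU).ct.continuous hs'
  have cut : Continuous (dt u s) :=
    ((F.smooth_u.mono Ioo_subset_Ico_self).dt isOpen_Ioo).ct.continuous hs
  have cρx : Continuous (dx ρ s) := (F.smooth_rho.dx hU).ct.continuous hs'
  set d := ∫ x in (0:ℝ)..1, dx u s x ^ 2 with hd
  have hd0 : 0 ≤ d := integral_nonneg' fun x => sq_nonneg _
  have hyd : enstrophy u s = 1 / 2 * d := intervalIntegral.integral_const_mul _ _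
  have h1 : ∫ x in (0:ℝ)..1, -(dx (dx u) s x * dt u s x) ≤ ∫ x in (0:ℝ)..1,
      R / μ * ((2 * K + d) * dx u s x ^ 2 + Q ^ 2 * dx ρ s x ^ 2 + γ ^ 2 * A ^ 2) := by
    refine integral_le (by fun_prop) (by fun_prop) fun x hx => ?_
    have hp := F.pos s x
    have hU2 : u s x ^ 2 ≤ 2 * K + d := by
      have h2 := sq_le_of_hasDerivAt (F.smooth_u.hasDerivAt_dx hs') cux hx
      linarith [hu s hs]
    have hQ2 : (deriv (deriv W) (ρ s x) + γ) ^ 2 ≤ Q ^ 2 := sq_le_sq'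
      (abs_le.1 (hQ s hs x hx)).1 (abs_le.1 (hQ s hs x hx)).2
    have hA2 : dx c s x ^ 2 ≤ A ^ 2 := sq_le_sq'
      (abs_le.1 (hA s hs x hx)).1 (abs_le.1 (hA s hs x hx)).2
    have hmom := F.momentum s hs x
    set w := deriv (deriv W) (ρ s x)
    set ν := μ / R with hν
    have hν0 : 0 < ν := div_pos hμ hR
    have hνρ : ν ≤ μ / ρ s x := div_le_div_of_nonneg_left hμ.le hp (hρ s hs x hx)
    have e1 : -(dx (dx u) s x * dt u s x) = u s x * dx u s x * dx (dx u) s x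
        + (w + γ) * dx ρ s x * dx (dx u) s x - γ * dx c s x * dx (dx u) s x
        - μ / ρ s x * dx (dx u) s x ^ 2 := by
      field_simp
      linear_combination (-dx (dx u) s x) * hmom
    have young : ∀ a b : ℝ, a * b ≤ R / μ * a ^ 2 + ν / 4 * b ^ 2 := by
      intro a b
      have e : R / μ = 1 / ν := by rw [hν, one_div_div]
      have e2 : 1 / ν * a ^ 2 + ν / 4 * b ^ 2 - a * b = 1 / ν * (a - ν / 2 * b) ^ 2 := by
        field_simp
        ring
      have : 0 ≤ 1 / ν * (a - ν / 2 * b) ^ 2 := by positivity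
      rw [e]
      linarith
    have y1 := young (u s x * dx u s x) (dx (dx u) s x)
    have y2 := young ((w + γ) * dx ρ s x) (dx (dx u) s x)
    have y3 := young (-(γ * dx c s x)) (dx (dx u) s x)
    have h3 : ν * dx (dx u) s x ^ 2 ≤ μ / ρ s x * dx (dx u) s x ^ 2 := by gcongr
    have h4 : 0 ≤ ν * dx (dx u) s x ^ 2 := by positivity
    have h5 : R / μ * ((u s x * dx u s x) ^ 2 + ((w + γ) * dx ρ s x) ^ 2
        + (-(γ * dx c s x)) ^ 2) ≤
        R / μ * ((2 * K + d) * dx u s x ^ 2 + Q ^ 2 * dx ρ s x ^ 2 + γ ^ 2 * A ^ 2) := by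
      rw [mul_pow, mul_pow, neg_sq, mul_pow]
      gcongr
    linarith
  refine h1.trans ?_
  have hi1 : IntervalIntegrable (fun x => (2 * K + d) * dx u s x ^ 2) volume 0 1 :=
    Continuous.intervalIntegrable (by fun_prop) _ _
  have hi2 : IntervalIntegrable (fun x => Q ^ 2 * dx ρ s x ^ 2) volume 0 1 :=
    Continuous.intervalIntegrable (by fun_prop) _ _
  rw [intervalIntegral.integral_const_mul, intervalIntegral.integral_add (hi1.add hi2)
    intervalIntegrable_const, intervalIntegral.integral_add hi1 hi2,
    intervalIntegral.integral_const_mul, intervalIntegral.integral_const_mul, ← hd, hyd]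
  simp only [intervalIntegral.integral_const, sub_zero, one_smul]
  have h6 : Q ^ 2 * (∫ x in (0:ℝ)..1, dx ρ s x ^ 2) ≤ Q ^ 2 * D := by
    gcongr
    exact hρx s hs
  have h7 : R / μ * (4 * K + Q ^ 2 * D + γ ^ 2 * A ^ 2) + R / μ * 2 * d =
    R / μ * (4 * K + Q ^ 2 * D + γ ^ 2 * A ^ 2 + 2 * d) := by ring
  rw [h7, mul_assoc]
  refine mul_le_mul_of_nonneg_left ?_ (by positivity)
  have h8 : 0 ≤ Q ^ 2 * D := by positivity
  nlinarith [mul_nonneg (add_nonneg h8 (mul_nonneg (sq_nonneg γ) (sq_nonneg A))) hd0,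
    mul_nonneg hK hd0]

end Flow

namespace Flow

variable {μ κ γ T : ℝ} {W : ℝ → ℝ} {ρ u c : ℝ → ℝ → ℝ} {t x M V : ℝ}

lemma integral_sobolev_densities (F : Flow μ κ γ T W ρ u c) (ht : t ∈ Ico 0 T) (a b s : ℝ) :
    ∫ x in (0:ℝ)..1, (a * (u t x ^ 2 + dx u t x ^ 2) + b
      + s * (ρ t x ^ 2 + dx ρ t x ^ 2)) =
    a * (∫ x in (0:ℝ)..1, (u t x ^ 2 + dx u t x ^ 2)) + b
      + s * ∫ x in (0:ℝ)..1, (ρ t x ^ 2 + dx ρ t x ^ 2) := by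
  have hU := uniqueDiffOn_Ico (0:ℝ) T
  have cρ : Continuous (ρ t) := F.smooth_rho.ct.continuous ht
  have cu : Continuous (u t) := F.smooth_u.ct.continuous ht
  have cρx : Continuous (dx ρ t) := (F.smooth_rho.dx hU).ct.continuous ht
  have cux : Continuous (dx u t) := (F.smooth_u.dx hU).ct.continuous ht
  have hi1 : IntervalIntegrable (fun x => a * (u t x ^ 2 + dx u t x ^ 2)) volume 0 1 :=
    Continuous.intervalIntegrable (by fun_prop) _ _
  have hi2 : IntervalIntegrable (fun x => s * (ρ t x ^ 2 + dx ρ t x ^ 2)) volume 0 1 :=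
    Continuous.intervalIntegrable (by fun_prop) _ _
  rw [intervalIntegral.integral_add (hi1.add intervalIntegrable_const) hi2,
    intervalIntegral.integral_add hi1 intervalIntegrable_const,
    intervalIntegral.integral_const_mul, intervalIntegral.integral_const_mul]
  simp

lemma energy_le_sobolev (F : Flow μ κ γ T W ρ u c)
    (hκ : 0 < κ) (hγ : 0 < γ) (ht : t ∈ Ico 0 T) (hM : ∀ x, ρ t x ≤ M)
    (hV : ∀ x, W (ρ t x) ≤ V) :
    energy κ γ W ρ u c t ≤ M / 2 * (∫ x in (0:ℝ)..1, (u t x ^ 2 + dx u t x ^ 2)) + V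
      + γ / 2 * ∫ x in (0:ℝ)..1, (ρ t x ^ 2 + dx ρ t x ^ 2) := by
  have hU := uniqueDiffOn_Ico (0:ℝ) T
  have cρ : Continuous (ρ t) := F.smooth_rho.ct.continuous ht
  have cu : Continuous (u t) := F.smooth_u.ct.continuous ht
  have cc : Continuous (c t) := F.smooth_c.ct.continuous ht
  have cρx : Continuous (dx ρ t) := (F.smooth_rho.dx hU).ct.continuous ht
  have cux : Continuous (dx u t) := (F.smooth_u.dx hU).ct.continuous ht
  have ccx : Continuous (dx c t) := (F.smooth_c.dx hU).ct.continuous ht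
  have ce := F.ct_energyDensity.continuous ht
  have h1 := integral_eq_of_flux (g := energyDensity κ γ W ρ u c t)
    (q := fun x => energyDensity κ γ W ρ u c t x
      - (γ * c t x ^ 2 - γ * ρ t x * c t x + κ * dx c t x ^ 2))
    (Φ := fun x => κ * (c t x * dx c t x)) ce (by fun_prop)
    (fun x => (((F.smooth_c.hasDerivAt_dx ht x).mul
      ((F.smooth_c.dx hU).hasDerivAt_dx ht x)).const_mul κ).congr_deriv (by
        linear_combination c t x * F.elliptic t ht x))
    (by simp only [eq_zero_one_of_periodic F.per_c,
      eq_zero_one_of_periodic (dx_periodic F.per_c)])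
  unfold energy
  rw [h1, ← F.integral_sobolev_densities ht]
  refine integral_le (by fun_prop) (by fun_prop) fun x _ => ?_
  have hp := F.pos t x
  have h2 : 1 / 2 * ρ t x * u t x ^ 2 ≤ M / 2 * u t x ^ 2 := by
    have := mul_le_mul_of_nonneg_right (hM x) (sq_nonneg (u t x))
    linarith
  have hM0 : 0 < M := hp.trans_le (hM x)
  have h3 : 0 ≤ M / 2 * dx u t x ^ 2 := by positivity
  have h4 : 0 ≤ γ / 2 * dx ρ t x ^ 2 := by positivity
  have h5 : 0 ≤ γ / 2 * c t x ^ 2 := by positivity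
  have h6 : 0 ≤ κ / 2 * dx c t x ^ 2 := by positivity
  have h7 := hV x
  unfold energyDensity
  nlinarith

lemma entropy_le_sobolev (F : Flow μ κ γ T W ρ u c) (hγ : 0 < γ) (hM0 : 0 < M) (ht : t ∈ Ico 0 T)
    (hM : ∀ x, M⁻¹ ≤ ρ t x ∧ ρ t x ≤ M) (hV : ∀ x, W (ρ t x) ≤ V) :
    entropy μ γ W ρ u t ≤ M * (∫ x in (0:ℝ)..1, (u t x ^ 2 + dx u t x ^ 2)) + V
      + (γ / 2 + μ ^ 2 * M ^ 3) * ∫ x in (0:ℝ)..1, (ρ t x ^ 2 + dx ρ t x ^ 2) := by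
  have hU := uniqueDiffOn_Ico (0:ℝ) T
  have cρ : Continuous (ρ t) := F.smooth_rho.ct.continuous ht
  have cu : Continuous (u t) := F.smooth_u.ct.continuous ht
  have cρx : Continuous (dx ρ t) := (F.smooth_rho.dx hU).ct.continuous ht
  have cux : Continuous (dx u t) := (F.smooth_u.dx hU).ct.continuous ht
  rw [← F.integral_sobolev_densities ht]
  refine integral_le (F.ct_entropyDensity.continuous ht) (by fun_prop) fun x _ => ?_
  have hp := F.pos t x
  have h1 : ρ t x * u t x ^ 2 ≤ M * u t x ^ 2 := by
    gcongr
    exact (hM x).2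
  have h2 : ρ t x * (μ * dx ρ t x / ρ t x ^ 2) ^ 2 ≤ μ ^ 2 * M ^ 3 * dx ρ t x ^ 2 := by
    have e : ρ t x * (μ * dx ρ t x / ρ t x ^ 2) ^ 2 =
        μ ^ 2 * (ρ t x)⁻¹ ^ 3 * dx ρ t x ^ 2 := by field_simp
    have h3 : (ρ t x)⁻¹ ≤ M := inv_le_of_inv_le₀ hM0 (hM x).1
    rw [e]
    gcongr
  have h3 : 0 ≤ M * dx u t x ^ 2 := by positivity
  have h4 : 0 ≤ γ / 2 * dx ρ t x ^ 2 := by positivity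
  have h5 : 0 ≤ μ ^ 2 * M ^ 3 * ρ t x ^ 2 := by positivity
  have h6 := hV x
  have h7 := mul_nonneg hp.le (sq_nonneg (u t x - μ * dx ρ t x / ρ t x ^ 2))
  unfold entropyDensity effVel
  nlinarith

/-- The velocity bound, with all constants given by the Sobolev norms of the data at time `0`
and by bounds `V`, `Q` for the potential. -/
lemma integral_velocity_le (F : Flow μ κ γ T W ρ u c)
    {E₀ A B₁ D r R Q y₀ N : ℝ} (hμ : 0 < μ) (hκ : 0 < κ) (hγ : 0 < γ)
    (hM0 : 0 < M) (hM : ∀ x, M⁻¹ ≤ ρ 0 x ∧ ρ 0 x ≤ M) (hV : ∀ x, W (ρ 0 x) ≤ V)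
    {n₁ n₂ : ℝ} (hn₁ : ∫ x in (0:ℝ)..1, (ρ 0 x ^ 2 + dx ρ 0 x ^ 2) = n₁)
    (hn₂ : ∫ x in (0:ℝ)..1, (u 0 x ^ 2 + dx u 0 x ^ 2) = n₂)
    (hE₀ : E₀ = M / 2 * n₂ + V + γ / 2 * n₁) (hA : A = γ / κ * (1 / 2 + E₀ / γ))
    (hB₁ : B₁ = (1 + (M * n₂ + V + (γ / 2 + μ ^ 2 * M ^ 3) * n₁))
      * Real.exp (γ * A * (M / 2 + 1) * T))
    (hD : D = (4 * B₁ + 4 * E₀) / μ ^ 2) (hr : r = Real.exp (-((D + M) / 2)) * M⁻¹)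
    (hR : R = Real.exp ((D + M) / 2) * M)
    (hQ : ∀ s ∈ Icc r R, |deriv (deriv W) s + γ| ≤ Q)
    (hN : N = 2 * E₀ / r)
    (hy₀ : y₀ = (1 + n₂) * Real.exp (R / μ * 2 / μ * E₀
      + R / μ * (4 * N + Q ^ 2 * (R ^ 3 * D) + γ ^ 2 * A ^ 2) * T)) (ht : t ∈ Ico 0 T) :
    ∫ x in (0:ℝ)..1, (u t x ^ 2 + dx u t x ^ 2) ≤ N + 2 * y₀ := by
  have hU := uniqueDiffOn_Ico (0:ℝ) T
  have hT0 : (0:ℝ) ∈ Ico 0 T := ⟨le_rfl, ht.1.trans_lt ht.2⟩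
  have cρ : ∀ {t}, t ∈ Ico 0 T → Continuous (ρ t) := fun ht => F.smooth_rho.ct.continuous ht
  have cu : ∀ {t}, t ∈ Ico 0 T → Continuous (u t) := fun ht => F.smooth_u.ct.continuous ht
  have cρx : ∀ {t}, t ∈ Ico 0 T → Continuous (dx ρ t) := fun ht =>
    (F.smooth_rho.dx hU).ct.continuous ht
  have cux : ∀ {t}, t ∈ Ico 0 T → Continuous (dx u t) := fun ht =>
    (F.smooth_u.dx hU).ct.continuous ht
  have hE : ∀ t ∈ Ico 0 T, energy κ γ W ρ u c t ≤ E₀ := fun t ht => by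
    rw [hE₀, ← hn₁, ← hn₂]
    exact (F.energy_le hμ ht).trans (F.energy_le_sobolev hκ hγ hT0 (fun x => (hM x).2) hV)
  have hE₀0 : 0 ≤ E₀ := (F.energy_nonneg hκ hγ t).trans (hE t ht)
  have hA0 : 0 ≤ A := by
    rw [hA]
    positivity
  have hcx : ∀ t ∈ Ico 0 T, ∀ x ∈ Icc (0:ℝ) 1, |dx c t x| ≤ A := fun t ht x hx => by
    rw [hA]
    exact F.abs_dx_c_le hκ hγ (hE t ht) ht hx
  have hm1 : ∀ t ∈ Ico 0 T, ∫ x in (0:ℝ)..1, ρ t x ≤ M := fun t ht => by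
    rw [F.integral_rho_eq ht]
    refine (integral_le (cρ hT0) continuous_const fun x _ => (hM x).2).trans ?_
    simp
  have hm2 : ∀ t ∈ Ico 0 T, M⁻¹ ≤ ∫ x in (0:ℝ)..1, ρ t x := fun t ht => by
    rw [F.integral_rho_eq ht]
    refine le_trans ?_ (integral_le continuous_const (cρ hT0) fun x _ => (hM x).1)
    simp
  have hB : ∀ t ∈ Ico 0 T, entropy μ γ W ρ u t ≤ B₁ := fun t ht => by
    refine (F.entropy_le hμ hγ hA0 hM0.le (fun s hs => hcx s (Ioo_subset_Ico_self hs))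
      (fun s hs => hm1 s (Ioo_subset_Ico_self hs)) ht).trans ?_
    rw [hB₁, ← hn₁, ← hn₂]
    gcongr
    exact F.entropy_le_sobolev hγ hM0 hT0 hM hV
  have hB₁0 : 0 ≤ B₁ := (F.entropy_nonneg hγ t).trans (hB t ht)
  have hD0 : 0 ≤ D := by
    rw [hD]
    positivity
  have hDt : ∀ t ∈ Ico 0 T, ∫ x in (0:ℝ)..1, dx ρ t x ^ 2 / ρ t x ^ 3 ≤ D := fun t ht => by
    rw [hD]
    exact F.integral_dx_rho_le hμ hκ hγ (hE t ht) (hB t ht) ht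
  have hρ : ∀ t ∈ Ico 0 T, ∀ x ∈ Icc (0:ℝ) 1, r ≤ ρ t x ∧ ρ t x ≤ R := fun t ht x hx => by
    rw [hr, hR]
    exact F.density_bounds (hDt t ht) (hm1 t ht) (hm2 t ht) ht hx
  have hr0 : 0 < r := by
    rw [hr]
    positivity
  have hR0 : 0 < R := by
    rw [hR]
    positivity
  have hu : ∀ t ∈ Ico 0 T, ∫ x in (0:ℝ)..1, u t x ^ 2 ≤ N := fun t ht => by
    have h1 : ∫ x in (0:ℝ)..1, u t x ^ 2 ≤
        ∫ x in (0:ℝ)..1, 2 / r * energyDensity κ γ W ρ u c t x := by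
      refine integral_le ((cu ht).pow 2) ((F.ct_energyDensity.continuous ht).const_mul _)
        fun x hx => ?_
      have hp := F.pos t x
      have hW := F.potential_nonneg _ hp
      have h2 : r * u t x ^ 2 ≤ ρ t x * u t x ^ 2 := by
        gcongr
        exact (hρ t ht x hx).1
      have h3 : 0 ≤ γ / 2 * (c t x - ρ t x) ^ 2 := by positivity
      have h4 : 0 ≤ κ / 2 * dx c t x ^ 2 := by positivity
      rw [div_mul_eq_mul_div, le_div_iff₀ hr0]
      unfold energyDensity
      linarith
    refine h1.trans ?_
    rw [intervalIntegral.integral_const_mul, hN, div_mul_eq_mul_div]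
    gcongr
    exact hE t ht
  have hN0 : 0 ≤ N := by
    rw [hN]
    positivity
  have hρx : ∀ t ∈ Ico 0 T, ∫ x in (0:ℝ)..1, dx ρ t x ^ 2 ≤ R ^ 3 * D := fun t ht => by
    have c3 : Continuous fun x => dx ρ t x ^ 2 / ρ t x ^ 3 :=
      ((cρx ht).pow 2).div ((cρ ht).pow 3) fun x => (pow_pos (F.pos t x) 3).ne'
    refine (integral_le ((cρx ht).pow 2) (c3.const_mul (R ^ 3)) fun x hx => ?_).trans ?_
    · have hp := F.pos t x
      have h1 : ρ t x ^ 3 ≤ R ^ 3 := pow_le_pow_left₀ hp.le (hρ t ht x hx).2 3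
      rw [← mul_div_assoc, le_div_iff₀ (by positivity), mul_comm]
      exact mul_le_mul_of_nonneg_right h1 (sq_nonneg (dx ρ t x))
    · rw [intervalIntegral.integral_const_mul]
      gcongr
      exact hDt t ht
  have hy := F.enstrophy_le hμ hκ hγ hN0 hR0 (D := R ^ 3 * D) (by positivity)
    (fun s hs => hcx s (Ioo_subset_Ico_self hs)) (fun s hs => hu s (Ioo_subset_Ico_self hs))
    (fun s hs x hx => (hρ s (Ioo_subset_Ico_self hs) x hx).2)
    (fun s hs => hρx s (Ioo_subset_Ico_self hs))
    (fun s hs x hx => hQ _ (hρ s (Ioo_subset_Ico_self hs) x hx)) ht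
  have hy' : enstrophy u t ≤ y₀ := by
    refine hy.trans ?_
    rw [hy₀]
    have h0 : enstrophy u 0 ≤ n₂ := by
      rw [← hn₂]
      have := cu hT0
      have := cux hT0
      refine integral_le (by fun_prop) (by fun_prop) fun x _ => ?_
      nlinarith [sq_nonneg (u 0 x), sq_nonneg (dx u 0 x)]
    have h1 : 0 ≤ n₂ := le_trans (integral_nonneg' fun x => by positivity) h0
    have h2 := hE 0 hT0
    gcongr
  have hi1 : IntervalIntegrable (fun x => u t x ^ 2) volume 0 1 :=
    ((cu ht).pow 2).intervalIntegrable _ _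
  have hi2 : IntervalIntegrable (fun x => dx u t x ^ 2) volume 0 1 :=
    ((cux ht).pow 2).intervalIntegrable _ _
  unfold enstrophy at hy'
  rw [intervalIntegral.integral_const_mul] at hy'
  rw [intervalIntegral.integral_add hi1 hi2]
  linarith [hu t ht]

end Flow

/-- A smooth periodic solution gives a flow in non-conservative form. -/
lemma flow_of_isNSKSolution {μ κ γ β a T : ℝ} {P W : ℝ → ℝ} {ρ u c : ℝ → ℝ → ℝ} {ρ₀ u₀ : ℝ → ℝ}
    (hP : IsAdmissiblePair P γ β a) (hW : IsPressurePotential P W)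
    (hS : IsNSKSolution μ κ γ P (Ico 0 T) ρ u c ρ₀ u₀) : Flow μ κ γ T W ρ u c := by
  have hρ : Sm (Ico 0 T) ρ := hS.smooth_rho
  have hu : Sm (Ico 0 T) u := hS.smooth_u
  have hc : Sm (Ico 0 T) c := hS.smooth_c
  have hW1 : ContDiffOn ℝ 1 (deriv W) (Ioi 0) :=
    hW.smooth.deriv_of_isOpen isOpen_Ioi (by norm_num)
  have hW2 : ContinuousOn (deriv (deriv W)) (Ioi 0) :=
    hW1.continuousOn_deriv_of_isOpen isOpen_Ioi le_rfl
  have hPd : ∀ r, 0 < r → HasDerivAt P (deriv P r) r := fun r hr =>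
    ((hP.smooth.differentiableOn (by simp) r hr.le).differentiableAt
      (Ici_mem_nhds hr)).hasDerivAt
  have hmass : ∀ t ∈ Ioo 0 T, ∀ x,
      dt ρ t x = -(dx ρ t x * u t x + ρ t x * dx u t x) := fun t ht x => by
    have ht' := Ioo_subset_Ico_self ht
    have h1 := hS.mass t ht' x
    have h2 : deriv (fun y => ρ t y * u t y) x = dx ρ t x * u t x + ρ t x * dx u t x :=
      ((hρ.hasDerivAt_dx ht' x).mul (hu.hasDerivAt_dx ht' x)).deriv
    rw [h2] at h1
    exact eq_neg_of_add_eq_zero_left h1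
  refine ⟨hρ, hu, hc, hS.periodic_rho, hS.periodic_u, hS.periodic_c, hS.rho_pos, hmass, ?_, ?_,
    fun r hr => hW.nonneg r hr.le, fun r hr => ?_, fun r hr => ?_, hW2, fun r hr => ?_⟩
  · intro t ht x
    have ht' := Ioo_subset_Ico_self ht
    have hpos := hS.rho_pos t x
    have h0 := hS.momentum t ht' x
    have e1 : deriv (fun s => ρ s x * u s x) t = dt ρ t x * u t x + ρ t x * dt u t x :=
      (((hρ.mono Ioo_subset_Ico_self).hasDerivAt_dt isOpen_Ioo ht x).mul
        ((hu.mono Ioo_subset_Ico_self).hasDerivAt_dt isOpen_Ioo ht x)).deriv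
    have e2 : deriv (fun y => ρ t y * u t y ^ 2) x =
        dx ρ t x * u t x ^ 2 + ρ t x * (2 * u t x * dx u t x) := by
      refine (HasDerivAt.deriv (f := fun y => ρ t y * u t y ^ 2)
        ((hρ.hasDerivAt_dx ht' x).mul ((hu.hasDerivAt_dx ht' x).pow 2))).trans ?_
      simp
    have e3 : deriv (fun y => P (ρ t y)) x = deriv P (ρ t x) * dx ρ t x :=
      ((hPd _ hpos).comp x (hρ.hasDerivAt_dx ht' x)).deriv
    have e4 : deriv (fun y => c t y - ρ t y) x = dx c t x - dx ρ t x :=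
      ((hc.hasDerivAt_dx ht' x).sub (hρ.hasDerivAt_dx ht' x)).deriv
    have e5 : deriv (deriv (u t)) x = dx (dx u) t x := rfl
    rw [e1, e2, e3, e4, e5, hmass t ht x] at h0
    rw [hW.relation _ hpos]
    linear_combination h0
  · intro t ht x
    have h0 := hS.elliptic t ht x
    have e : deriv (deriv (c t)) x = dx (dx c) t x := rfl
    rw [e] at h0
    linear_combination -h0
  · exact ((hW.smooth.differentiableOn (by simp) r hr).differentiableAt
      (Ioi_mem_nhds hr)).hasDerivAt
  · exact ((hW1.differentiableOn (by simp) r hr).differentiableAt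
      (Ioi_mem_nhds hr)).hasDerivAt
  · have h1 : HasDerivAt (artificialPressure P γ) (deriv P r + γ * r) r := by
      have h2 := (hPd r hr).add (((hasDerivAt_id r).pow 2).const_mul (γ / 2))
      refine h2.congr_deriv ?_
      simp
      ring
    have h2 : 0 ≤ deriv P r + γ * r := by
      have h3 : 0 ≤ derivWithin (artificialPressure P γ) (Ici 0) r :=
        hP.mono.derivWithin_nonneg
      rwa [derivWithin_of_mem_nhds (Ici_mem_nhds hr), h1.deriv] at h3
    rw [← hW.relation r hr, ← add_mul] at h2
    exact nonneg_of_mul_nonneg_left h2 hr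

lemma sq_H1norm (f : ℝ → ℝ) : ∫ x in (0:ℝ)..1, (f x ^ 2 + deriv f x ^ 2) = H1norm f ^ 2 :=
  (Real.sq_sqrt (integral_nonneg' fun x => by positivity)).symm

/-- The velocity bound with a constant chosen before the solution. -/
lemma exists_velocity_bound (h₁ h₂ M μ κ γ : ℝ) (W : ℝ → ℝ) (T : ℝ) :
    ∃ K : ℝ, 0 < K ∧ ∀ (β a : ℝ) (P : ℝ → ℝ) (ρ u c : ℝ → ℝ → ℝ) (ρ₀ u₀ : ℝ → ℝ),
      0 < μ → 0 < κ → 0 < M → IsAdmissiblePair P γ β a → IsPressurePotential P W →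
      IsNSKSolution μ κ γ P (Ico 0 T) ρ u c ρ₀ u₀ → (∀ x, M⁻¹ ≤ ρ₀ x ∧ ρ₀ x ≤ M) →
      H1norm ρ₀ = h₁ → H1norm u₀ = h₂ → ∀ t ∈ Ico 0 T, H1norm (u t) ≤ K := by
  by_cases h : 0 < M ∧ ContDiffOn ℝ 2 W (Ioi 0)
  · obtain ⟨hM0, hW⟩ := h
    have hW2 : ContinuousOn (deriv (deriv W)) (Ioi 0) :=
      (hW.deriv_of_isOpen (m := 1) isOpen_Ioi (by norm_num)).continuousOn_deriv_of_isOpen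
        isOpen_Ioi le_rfl
    obtain ⟨V, hV⟩ := (isCompact_Icc (a := M⁻¹) (b := M)).exists_bound_of_continuousOn
      (hW.continuousOn.mono fun s hs => (inv_pos.2 hM0).trans_le hs.1)
    obtain ⟨E₀, hE₀⟩ : ∃ E₀, E₀ = M / 2 * h₂ ^ 2 + V + γ / 2 * h₁ ^ 2 := ⟨_, rfl⟩
    obtain ⟨A, hA⟩ : ∃ A, A = γ / κ * (1 / 2 + E₀ / γ) := ⟨_, rfl⟩
    obtain ⟨B₁, hB₁⟩ : ∃ B₁, B₁ =
        (1 + (M * h₂ ^ 2 + V + (γ / 2 + μ ^ 2 * M ^ 3) * h₁ ^ 2))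
          * Real.exp (γ * A * (M / 2 + 1) * T) := ⟨_, rfl⟩
    obtain ⟨D, hD⟩ : ∃ D, D = (4 * B₁ + 4 * E₀) / μ ^ 2 := ⟨_, rfl⟩
    obtain ⟨r, hr⟩ : ∃ r, r = Real.exp (-((D + M) / 2)) * M⁻¹ := ⟨_, rfl⟩
    obtain ⟨R, hR⟩ : ∃ R, R = Real.exp ((D + M) / 2) * M := ⟨_, rfl⟩
    have hr0 : 0 < r := by
      rw [hr]
      positivity
    obtain ⟨Q, hQ⟩ := (isCompact_Icc (a := r) (b := R)).exists_bound_of_continuousOn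
      ((hW2.mono fun s hs => hr0.trans_le hs.1).add (continuousOn_const (c := γ)))
    obtain ⟨N, hN⟩ : ∃ N, N = 2 * E₀ / r := ⟨_, rfl⟩
    obtain ⟨y₀, hy₀⟩ : ∃ y₀, y₀ = (1 + h₂ ^ 2) * Real.exp (R / μ * 2 / μ * E₀
      + R / μ * (4 * N + Q ^ 2 * (R ^ 3 * D) + γ ^ 2 * A ^ 2) * T) := ⟨_, rfl⟩
    refine ⟨Real.sqrt (N + 2 * y₀) + 1, by positivity, ?_⟩
    intro β a P ρ u c ρ₀ u₀ hμ hκ _ hP hWP hS hM hh₁ hh₂ t ht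
    have F := flow_of_isNSKSolution hP hWP hS
    have hρ0 : ρ 0 = ρ₀ := funext hS.init_rho
    have hu0 : u 0 = u₀ := funext hS.init_u
    have hn₁ : ∫ x in (0:ℝ)..1, (ρ 0 x ^ 2 + dx ρ 0 x ^ 2) = h₁ ^ 2 := by
      rw [← hh₁, ← hρ0]
      exact sq_H1norm (ρ 0)
    have hn₂ : ∫ x in (0:ℝ)..1, (u 0 x ^ 2 + dx u 0 x ^ 2) = h₂ ^ 2 := by
      rw [← hh₂, ← hu0]
      exact sq_H1norm (u 0)
    have hM' : ∀ x, M⁻¹ ≤ ρ 0 x ∧ ρ 0 x ≤ M := by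
      rw [hρ0]
      exact hM
    have hb := F.integral_velocity_le hμ hκ hP.gamma_pos hM0 hM'
      (fun x => (le_abs_self _).trans (hV _ ⟨(hM' x).1, (hM' x).2⟩)) hn₁ hn₂ hE₀ hA hB₁ hD hr hR
      hQ hN hy₀ ht
    exact (Real.sqrt_le_sqrt hb).trans (le_add_of_nonneg_right zero_le_one)
  · refine ⟨1, one_pos, ?_⟩
    intro _ _ P ρ u c ρ₀ u₀ _ _ hM0 _ hWP
    exact absurd ⟨hM0, hWP.smooth⟩ h

end NSK

/-- Uniform-in-time `H¹` bound for the velocity: there is `C(T₀) > 0`, depending only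
on `‖ρ₀‖_{H¹}`, `‖u₀‖_{H¹}`, `M₀`, `μ`, `κ`, `γ`, `W` and `T₀`, such that
`‖u(t,·)‖_{H¹(𝕋)} ≤ C(T₀)` for all `t ∈ [0,T₀)`. -/
theorem velocity_H1_bound :
    ∃ C : ℝ → ℝ → ℝ → ℝ → ℝ → ℝ → (ℝ → ℝ) → ℝ → ℝ,
      ∀ (μ κ γ M₀ T₀ β a : ℝ) (P W : ℝ → ℝ) (ρ u c : ℝ → ℝ → ℝ) (ρ₀ u₀ : ℝ → ℝ),
        0 < μ → 0 < κ → 0 < γ → 0 < M₀ → 0 < T₀ →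
        IsAdmissiblePair P γ β a → IsPressurePotential P W →
        IsNSKSolution μ κ γ P (Set.Ico 0 T₀) ρ u c ρ₀ u₀ →
        (∀ x : ℝ, M₀⁻¹ ≤ ρ₀ x ∧ ρ₀ x ≤ M₀) →
        0 < C (H1norm ρ₀) (H1norm u₀) M₀ μ κ γ W T₀ ∧
        ∀ t ∈ Set.Ico 0 T₀,
          H1norm (u t) ≤ C (H1norm ρ₀) (H1norm u₀) M₀ μ κ γ W T₀ := by
  choose C hpos hC using NSK.exists_velocity_bound
  refine ⟨C, ?_⟩
  intro μ κ γ M₀ T₀ β a P W ρ u c ρ₀ u₀ hμ hκ _ hM₀ _ hP hW hS hM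
  exact ⟨hpos _ _ _ _ _ _ _ _,
    hC _ _ _ _ _ _ _ _ β a P ρ u c ρ₀ u₀ hμ hκ hM₀ hP hW hS hM rfl rfl⟩
end

section
/- Let μ, κ, γ, M₀ > 0, let (P,γ) be an admissible pair with pressure potential W, and let (ρ,u,c) be a smooth periodic solution of the non-local Navier–Stokes–Korteweg system on [0,∞) with initial data (ρ₀,u₀) satisfying M₀⁻¹ ≤ ρ₀(x) ≤ M₀ for all x. Then there exist a time T₀ > 0 and a constant C₀ > 0, both depending only on M₀, ‖u₀‖_{H¹(𝕋)}, γ, κ, μ, P and W, such that: (i) (2M₀)⁻¹ ≤ ρ(t,x) ≤ 2M₀ for all (t,x) ∈ [0,T₀] × ℝ, and (ii) sup_{t∈[0,T₀]} ‖u(t,·)‖²_{H¹(𝕋)} + ∫₀^{T₀} ‖∂_x Σ(t,·)‖²_{L²(𝕋)} dt ≤ C₀, where the effective viscous flux is Σ := μ·∂_x u − P_γ(ρ) with P_γ(r) := P(r) + (γ/2)·r². -/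
open MeasureTheory Filter Set

open scoped ContDiff

lemma hasDerivAt_space {F : ℝ → ℝ → ℝ}
    (hF : ContDiffOn ℝ ∞ (fun p : ℝ × ℝ => F p.1 p.2) (Ici 0 ×ˢ univ)) {t : ℝ} (ht : 0 ≤ t)
    (x : ℝ) :
    HasDerivAt (F t)
      (fderivWithin ℝ (fun p : ℝ × ℝ => F p.1 p.2) (Ici 0 ×ˢ univ) (t, x) (0, 1)) x := by
  have hd : HasFDerivWithinAt (fun p : ℝ × ℝ => F p.1 p.2) _ (Ici 0 ×ˢ univ) (t, x) :=
    (hF.differentiableOn (by simp) (t, x) ⟨ht, mem_univ x⟩).hasFDerivWithinAt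
  have hc : HasDerivWithinAt (fun y : ℝ => (t, y)) (0, 1) univ x :=
    ((hasDerivAt_const x t).prodMk (hasDerivAt_id x)).hasDerivWithinAt
  simpa [Function.comp_def] using
    (hd.comp_hasDerivWithinAt x hc fun y _ => ⟨ht, mem_univ y⟩).hasDerivAt univ_mem

lemma contDiffOn_deriv_space {F : ℝ → ℝ → ℝ}
    (hF : ContDiffOn ℝ ∞ (fun p : ℝ × ℝ => F p.1 p.2) (Ici 0 ×ˢ univ)) :
    ContDiffOn ℝ ∞ (fun p : ℝ × ℝ => deriv (F p.1) p.2) (Ici 0 ×ˢ univ) := by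
  have hu : UniqueDiffOn ℝ (Ici (0 : ℝ) ×ˢ (univ : Set ℝ)) :=
    (uniqueDiffOn_Ici 0).prod uniqueDiffOn_univ
  refine ((hF.fderivWithin hu (m := ∞) (by simp)).clm_apply
    (contDiffOn_const (c := ((0, 1) : ℝ × ℝ)))).congr fun p hp => ?_
  exact (hasDerivAt_space hF hp.1 p.2).deriv

lemma differentiableAt_space {F : ℝ → ℝ → ℝ}
    (hF : ContDiffOn ℝ ∞ (fun p : ℝ × ℝ => F p.1 p.2) (Ici 0 ×ˢ univ)) {t : ℝ} (ht : 0 ≤ t)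
    (x : ℝ) : DifferentiableAt ℝ (F t) x :=
  (hasDerivAt_space hF ht x).differentiableAt

lemma contDiffAt_of_pos {F : ℝ → ℝ → ℝ}
    (hF : ContDiffOn ℝ ∞ (fun p : ℝ × ℝ => F p.1 p.2) (Ici 0 ×ˢ univ)) {t : ℝ} (ht : 0 < t)
    (x : ℝ) : ContDiffAt ℝ ∞ (fun p : ℝ × ℝ => F p.1 p.2) (t, x) :=
  hF.contDiffAt (prod_mem_nhds (Ici_mem_nhds ht) univ_mem)

lemma hasDerivAt_time {F : ℝ → ℝ → ℝ} {t x : ℝ}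
    (hF : DifferentiableAt ℝ (fun p : ℝ × ℝ => F p.1 p.2) (t, x)) :
    HasDerivAt (fun s => F s x) (fderiv ℝ (fun p : ℝ × ℝ => F p.1 p.2) (t, x) (1, 0)) t := by
  simpa [Function.comp_def] using hF.hasFDerivAt.comp_hasDerivAt t
    ((hasDerivAt_id t).prodMk (hasDerivAt_const t x))

lemma differentiableAt_time {F : ℝ → ℝ → ℝ}
    (hF : ContDiffOn ℝ ∞ (fun p : ℝ × ℝ => F p.1 p.2) (Ici 0 ×ˢ univ)) {t : ℝ} (ht : 0 < t)
    (x : ℝ) : DifferentiableAt ℝ (fun s => F s x) t :=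
  (hasDerivAt_time ((contDiffAt_of_pos hF ht x).differentiableAt (by simp))).differentiableAt

lemma contDiffAt_deriv_time {F : ℝ → ℝ → ℝ}
    (hF : ContDiffOn ℝ ∞ (fun p : ℝ × ℝ => F p.1 p.2) (Ici 0 ×ˢ univ)) {t : ℝ} (ht : 0 < t)
    (x : ℝ) : ContDiffAt ℝ ∞ (fun p : ℝ × ℝ => deriv (fun s => F s p.2) p.1) (t, x) := by
  refine (((contDiffAt_of_pos hF ht x).fderiv_right (m := ∞) (by simp)).clm_apply
    (contDiffAt_const (c := ((1, 0) : ℝ × ℝ)))).congr_of_eventuallyEq ?_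
  filter_upwards [prod_mem_nhds (Ioi_mem_nhds ht) (univ_mem (f := nhds x))] with p hp
  exact (hasDerivAt_time ((contDiffAt_of_pos hF hp.1 p.2).differentiableAt (by simp))).deriv

lemma hasDerivAt_space' {F : ℝ → ℝ → ℝ} {t x : ℝ}
    (hF : DifferentiableAt ℝ (fun p : ℝ × ℝ => F p.1 p.2) (t, x)) :
    HasDerivAt (F t) (fderiv ℝ (fun p : ℝ × ℝ => F p.1 p.2) (t, x) (0, 1)) x := by
  simpa [Function.comp_def] using hF.hasFDerivAt.comp_hasDerivAt x
    ((hasDerivAt_const x t).prodMk (hasDerivAt_id x))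

/-- Mixed partial derivatives commute for `t > 0`. -/
lemma deriv_deriv_comm {F : ℝ → ℝ → ℝ}
    (hF : ContDiffOn ℝ ∞ (fun p : ℝ × ℝ => F p.1 p.2) (Ici 0 ×ˢ univ)) {t : ℝ} (ht : 0 < t)
    (x : ℝ) :
    deriv (fun s => deriv (F s) x) t = deriv (fun y => deriv (fun s => F s y) t) x := by
  set U : ℝ × ℝ → ℝ := fun p => F p.1 p.2 with hU
  have hd : ∀ s, 0 < s → ∀ y, DifferentiableAt ℝ U (s, y) := fun s hs y =>
    (contDiffAt_of_pos hF hs y).differentiableAt (by simp)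
  have hUt : ContDiffAt ℝ ∞ U (t, x) := contDiffAt_of_pos hF ht x
  have hfd : DifferentiableAt ℝ (fderiv ℝ U) (t, x) :=
    (hUt.fderiv_right (m := ∞) (by simp)).differentiableAt (by simp)
  have hsymm : IsSymmSndFDerivAt ℝ U (t, x) :=
    hUt.isSymmSndFDerivAt (by simpa using WithTop.coe_le_coe.2 (le_top : (2 : ℕ∞) ≤ ⊤))
  have h1 : (fun s => deriv (F s) x) =ᶠ[nhds t] fun s => fderiv ℝ U (s, x) (0, 1) := by
    filter_upwards [Ioi_mem_nhds ht] with s hs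
    exact (hasDerivAt_space' (hd s hs x)).deriv
  have h2 : (fun y => deriv (fun s => F s y) t) = fun y => fderiv ℝ U (t, y) (1, 0) := by
    funext y
    exact (hasDerivAt_time (hd t ht y)).deriv
  have e1 : HasDerivAt (fun s => fderiv ℝ U (s, x) (0, 1))
      (fderiv ℝ (fderiv ℝ U) (t, x) (1, 0) (0, 1)) t := by
    have hl : HasDerivAt (fun s => fderiv ℝ U (s, x)) (fderiv ℝ (fderiv ℝ U) (t, x) (1, 0)) t :=
      hfd.hasFDerivAt.comp_hasDerivAt t ((hasDerivAt_id t).prodMk (hasDerivAt_const t x))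
    simpa using hl.clm_apply (hasDerivAt_const t ((0, 1) : ℝ × ℝ))
  have e2 : HasDerivAt (fun y => fderiv ℝ U (t, y) (1, 0))
      (fderiv ℝ (fderiv ℝ U) (t, x) (0, 1) (1, 0)) x := by
    have hl : HasDerivAt (fun y => fderiv ℝ U (t, y)) (fderiv ℝ (fderiv ℝ U) (t, x) (0, 1)) x :=
      hfd.hasFDerivAt.comp_hasDerivAt x ((hasDerivAt_const x t).prodMk (hasDerivAt_id x))
    simpa using hl.clm_apply (hasDerivAt_const x ((1, 0) : ℝ × ℝ))
  rw [h1.deriv_eq, h2, e1.deriv, e2.deriv]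
  exact hsymm _ _

/-- Differentiation under the integral sign for `t > 0`. -/
lemma hasDerivAt_integral_unit {F F' : ℝ → ℝ → ℝ}
    (hF : ContinuousOn (fun p : ℝ × ℝ => F p.1 p.2) (Ioi 0 ×ˢ univ))
    (hF' : ContinuousOn (fun p : ℝ × ℝ => F' p.1 p.2) (Ioi 0 ×ˢ univ))
    (hd : ∀ t, 0 < t → ∀ x, HasDerivAt (fun s => F s x) (F' t x) t) {t : ℝ} (ht : 0 < t) :
    HasDerivAt (fun s => ∫ x in (0:ℝ)..1, F s x) (∫ x in (0:ℝ)..1, F' t x) t := by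
  have hslice : ∀ {G : ℝ → ℝ → ℝ}, ContinuousOn (fun p : ℝ × ℝ => G p.1 p.2) (Ioi 0 ×ˢ univ) →
      ∀ s, 0 < s → Continuous (G s) := fun {G} hG s hs =>
    continuousOn_univ.1 (hG.comp (f := fun y : ℝ => (s, y)) (by fun_prop)
      fun y _ => ⟨hs, mem_univ y⟩)
  have hK : IsCompact (Icc (t / 2) (2 * t) ×ˢ Icc (0:ℝ) 1) := isCompact_Icc.prod isCompact_Icc
  obtain ⟨C, hC⟩ := hK.exists_bound_of_continuousOn
    (hF'.mono (prod_mono (fun s hs => lt_of_lt_of_le (half_pos ht) hs.1) (subset_univ _)))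
  have hnh : Icc (t / 2) (2 * t) ∈ nhds t := Icc_mem_nhds (by linarith) (by linarith)
  refine (intervalIntegral.hasDerivAt_integral_of_dominated_loc_of_deriv_le
    (bound := fun _ => C) hnh ?_ ?_ ?_ ?_ ?_ ?_).2
  · filter_upwards [Ioi_mem_nhds ht] with s hs
    exact (hslice hF s hs).aestronglyMeasurable
  · exact (hslice hF t ht).intervalIntegrable _ _
  · exact (hslice hF' t ht).aestronglyMeasurable
  · refine Eventually.of_forall fun x hx s hs => hC (s, x) ⟨hs, ?_⟩
    rw [uIoc_of_le zero_le_one] at hx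
    exact Ioc_subset_Icc_self hx
  · exact intervalIntegrable_const
  · exact Eventually.of_forall fun x _ s hs => hd s (lt_of_lt_of_le (half_pos ht) hs.1) x

lemma continuousOn_integral_unit {F : ℝ → ℝ → ℝ}
    (hF : ContinuousOn (fun p : ℝ × ℝ => F p.1 p.2) (Ici 0 ×ˢ univ)) :
    ContinuousOn (fun s => ∫ x in (0:ℝ)..1, F s x) (Ici 0) := by
  have hc : Continuous (Function.uncurry fun s x => F (max s 0) x) :=
    hF.comp_continuous (f := fun p : ℝ × ℝ => (max p.1 0, p.2)) (by fun_prop)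
      fun p => ⟨mem_Ici.2 (le_max_right _ _), mem_univ _⟩
  refine (intervalIntegral.continuous_parametric_intervalIntegral_of_continuous' (μ := volume) hc 0 1
    ).continuousOn.congr fun s hs => ?_
  simp [max_eq_left (mem_Ici.1 hs)]

/-- A Sobolev-type bound on the unit interval. -/
lemma abs_le_of_abs_integral_le {f f' : ℝ → ℝ} (hd : ∀ x, HasDerivAt f (f' x) x)
    (hc : Continuous f') {A θ : ℝ} (hA : |∫ x in (0:ℝ)..1, f x| ≤ A) (hθ : 0 < θ) {x : ℝ}
    (hx : x ∈ Icc (0:ℝ) 1) :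
    |f x| ≤ A + (1 / (4 * θ) + θ * ∫ y in (0:ℝ)..1, f' y ^ 2) := by
  have hf : Continuous f := continuous_iff_continuousAt.2 fun x => (hd x).continuousAt
  set B := 1 / (4 * θ) + θ * ∫ y in (0:ℝ)..1, f' y ^ 2 with hB
  have hint : ∫ y in (0:ℝ)..1, |f' y| ≤ B := by
    have h1 : ∫ y in (0:ℝ)..1, (1 / (4 * θ) + θ * f' y ^ 2) = B := by
      rw [intervalIntegral.integral_add (by simp)
        (Continuous.intervalIntegrable (by fun_prop) _ _)]
      simp [hB]
    rw [← h1]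
    refine intervalIntegral.integral_mono_on zero_le_one
      (Continuous.intervalIntegrable (by fun_prop) _ _)
      (Continuous.intervalIntegrable (by fun_prop) _ _) fun y _ => ?_
    have h2 : 1 / (4 * θ) + θ * f' y ^ 2 - |f' y| = (2 * θ * |f' y| - 1) ^ 2 / (4 * θ) := by
      rw [← sq_abs (f' y)]; field_simp; ring
    have h3 : 0 ≤ (2 * θ * |f' y| - 1) ^ 2 / (4 * θ) := by positivity
    linarith
  have hdiff : ∀ y ∈ Icc (0:ℝ) 1, |f x - f y| ≤ B := by
    intro y hy
    have h1 : ∫ z in y..x, f' z = f x - f y :=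
      intervalIntegral.integral_eq_sub_of_hasDerivAt (fun z _ => hd z)
        (hc.intervalIntegrable _ _)
    rw [← h1]
    refine le_trans ?_ hint
    refine (intervalIntegral.norm_integral_le_integral_norm_uIoc (f := f')).trans ?_
    rw [intervalIntegral.integral_of_le zero_le_one]
    refine setIntegral_mono_set ?_ (Eventually.of_forall fun z => abs_nonneg _) ?_
    · exact (hc.abs.intervalIntegrable 0 1).1
    · refine (Ioc_subset_Ioc (le_min hy.1 hx.1) (max_le hy.2 hx.2)).eventuallyLE
  have h1 : ∫ y in (0:ℝ)..1, (f x - f y) = f x - ∫ y in (0:ℝ)..1, f y := by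
    rw [intervalIntegral.integral_sub (by simp) (hf.intervalIntegrable _ _)]
    simp
  have h2 : |∫ y in (0:ℝ)..1, (f x - f y)| ≤ B := by
    have := intervalIntegral.norm_integral_le_of_norm_le_const (a := (0:ℝ)) (b := 1) (C := B)
      (f := fun y => f x - f y) fun y hy => by
        rw [uIoc_of_le zero_le_one] at hy
        exact hdiff y (Ioc_subset_Icc_self hy)
    simpa using this
  rw [h1] at h2
  have := abs_add_le (f x - ∫ y in (0:ℝ)..1, f y) (∫ y in (0:ℝ)..1, f y)
  rw [sub_add_cancel] at this
  linarith

lemma periodic_one_eq_fract {f : ℝ → ℝ} (hf : ∀ x, f (x + 1) = f x) (x : ℝ) :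
    f x = f (Int.fract x) := by
  have h : Function.Periodic f 1 := hf
  rw [← Int.self_sub_floor, ← mul_one (⌊x⌋ : ℝ), h.sub_int_mul_eq]

lemma lt_zero_of_forall_le_imp_lt_zero {g : ℝ → ℝ → ℝ} {T : ℝ}
    (hg : ContinuousOn (fun p : ℝ × ℝ => g p.1 p.2) (Icc 0 T ×ˢ Icc 0 1))
    (h0 : ∀ x ∈ Icc (0:ℝ) 1, g 0 x < 0)
    (hstep : ∀ t ∈ Icc 0 T, (∀ s ∈ Icc 0 t, ∀ x ∈ Icc (0:ℝ) 1, g s x ≤ 0) →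
      ∀ x ∈ Icc (0:ℝ) 1, g t x < 0) :
    ∀ t ∈ Icc 0 T, ∀ x ∈ Icc (0:ℝ) 1, g t x < 0 := by
  by_contra! hcon
  obtain ⟨t', ht', x', hx', hbad⟩ := hcon
  set K : Set (ℝ × ℝ) := (Icc 0 T ×ˢ Icc 0 1) ∩ (fun p : ℝ × ℝ => g p.1 p.2) ⁻¹' Ici 0 with hK
  have hKc : IsCompact K := by
    refine (isCompact_Icc.prod isCompact_Icc).of_isClosed_subset
      (hg.preimage_isClosed_of_isClosed (isClosed_Icc.prod isClosed_Icc) isClosed_Ici)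
      inter_subset_left
  obtain ⟨⟨t, x⟩, ⟨⟨ht, hx⟩, hge⟩, hmin⟩ :=
    hKc.exists_isMinOn ⟨(t', x'), ⟨ht', hx'⟩, hbad⟩ continuous_fst.continuousOn
  have hlt : ∀ s ∈ Ico 0 t, ∀ y ∈ Icc (0:ℝ) 1, g s y < 0 := by
    intro s hs y hy
    by_contra! hc
    have : t ≤ s := hmin (a := (s, y)) ⟨⟨⟨hs.1, hs.2.le.trans ht.2⟩, hy⟩, hc⟩
    exact absurd hs.2 (not_lt.2 this)
  have htpos : 0 < t := by
    refine lt_of_le_of_ne ht.1 ?_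
    rintro rfl
    exact absurd (h0 x hx) (not_lt.2 hge)
  refine absurd (hstep t ht ?_ x hx) (not_lt.2 hge)
  intro s hs y hy
  rcases hs.2.lt_or_eq with h | rfl
  · exact (hlt s ⟨hs.1, h⟩ y hy).le
  · have hcl : s ∈ closure (Ico 0 s) := by
      rw [closure_Ico htpos.ne]; exact ⟨htpos.le, le_rfl⟩
    have hcont : ContinuousWithinAt (fun r => g r y) (Ico 0 s) s :=
      (hg (s, y) ⟨ht, hy⟩).comp (f := fun r : ℝ => (r, y)) (by fun_prop)
        fun r hr => ⟨⟨hr.1, hr.2.le.trans ht.2⟩, hy⟩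
    have hne : (nhdsWithin s (Ico 0 s)).NeBot := mem_closure_iff_nhdsWithin_neBot.1 hcl
    refine le_of_tendsto hcont ?_
    filter_upwards [self_mem_nhdsWithin] with r hr
    exact (hlt r hr y hy).le

lemma deriv_nonneg_of_forall_le {f : ℝ → ℝ} {f' t : ℝ} (ht : 0 < t) (hf : HasDerivAt f f' t)
    (hmax : ∀ s ∈ Icc 0 t, f s ≤ f t) : 0 ≤ f' := by
  have h := hf.hasDerivWithinAt (s := Iio t)
  rw [hasDerivWithinAt_iff_tendsto_slope' (by simp)] at h
  refine ge_of_tendsto h ?_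
  filter_upwards [Ioo_mem_nhdsLT ht] with s hs
  rw [slope_def_field]
  exact div_nonneg_of_nonpos (by linarith [hmax s ⟨hs.1.le, hs.2.le⟩]) (by linarith [hs.2])

/-- Maximum principle for a periodic function that is transported with a source term. -/
lemma transport_max_principle {f ft fx u : ℝ → ℝ → ℝ} {T : ℝ}
    (hf : ContinuousOn (fun p : ℝ × ℝ => f p.1 p.2) (Ici 0 ×ˢ univ))
    (hper : ∀ t x, f t (x + 1) = f t x)
    (hdt : ∀ t, 0 < t → ∀ x, HasDerivAt (fun s => f s x) (ft t x) t)
    (hdx : ∀ t, 0 < t → ∀ x, HasDerivAt (f t) (fx t x) x)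
    (hneg : ∀ t ∈ Ioc 0 T, ∀ x ∈ Icc (0:ℝ) 1, ft t x + u t x * fx t x < 0)
    (h0 : ∀ x, f 0 x ≤ 0) :
    ∀ t ∈ Icc 0 T, ∀ x, f t x ≤ 0 := by
  have hred : ∀ t x, f t x = f t (Int.fract x) := fun t =>
    periodic_one_eq_fract (hper t)
  intro t' ht' x'
  by_contra! hcon
  have hfr : ∀ x : ℝ, Int.fract x ∈ Icc (0:ℝ) 1 := fun x =>
    ⟨Int.fract_nonneg x, (Int.fract_lt_one x).le⟩
  obtain ⟨⟨t, x⟩, ⟨ht, hx⟩, hmax⟩ :=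
    (isCompact_Icc.prod isCompact_Icc : IsCompact (Icc 0 T ×ˢ Icc (0:ℝ) 1)).exists_isMaxOn
      ⟨(t', Int.fract x'), ht', hfr x'⟩
      (hf.mono (prod_mono (fun s hs => hs.1) (subset_univ _)))
  have hall : ∀ s ∈ Icc 0 T, ∀ y, f s y ≤ f t x := fun s hs y => by
    rw [hred s y]; exact hmax (a := (s, Int.fract y)) ⟨hs, hfr y⟩
  have hpos : 0 < f t x := hcon.trans_le (hall t' ht' x')
  have htpos : 0 < t := by
    refine lt_of_le_of_ne ht.1 ?_
    rintro rfl
    exact absurd (h0 x) (not_le.2 hpos)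
  have hfx : fx t x = 0 :=
    IsLocalMax.hasDerivAt_eq_zero (Eventually.of_forall fun y => hall t ht y) (hdx t htpos x)
  have hft : 0 ≤ ft t x := deriv_nonneg_of_forall_le htpos (hdt t htpos x)
    fun s hs => hall s ⟨hs.1, hs.2.trans ht.2⟩ x
  have := hneg t ⟨htpos, ht.2⟩ x hx
  rw [hfx] at this
  linarith

/-- Bootstrap: bounds that improve themselves persist on a short time interval. -/
lemma bootstrap_bounds {h ht hx u ux : ℝ → ℝ → ℝ} {E E' : ℝ → ℝ} {L L₀ R K K₂ η T : ℝ}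
    (hη : 0 ≤ η) (hK : 0 ≤ K) (hK₂ : 0 ≤ K₂)
    (hc : ContinuousOn (fun p : ℝ × ℝ => h p.1 p.2) (Ici 0 ×ˢ univ))
    (hper : ∀ t x, h t (x + 1) = h t x)
    (hdt : ∀ t, 0 < t → ∀ x, HasDerivAt (fun s => h s x) (ht t x) t)
    (hdx : ∀ t, 0 < t → ∀ x, HasDerivAt (h t) (hx t x) x)
    (htr : ∀ t, 0 < t → ∀ x, ht t x + u t x * hx t x = -ux t x)
    (hEc : ContinuousOn E (Ici 0)) (hEd : ∀ t, 0 < t → HasDerivAt E (E' t) t)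
    (hE0 : ∀ t, 0 ≤ E t)
    (hux : ∀ t, 0 < t → (∀ x, |h t x| ≤ L) → E t ≤ R → ∀ x ∈ Icc (0:ℝ) 1,
      |ux t x| < K₂ - η * E' t)
    (hE' : ∀ t, 0 < t → (∀ x, |h t x| ≤ L) → E t ≤ R → E' t ≤ K)
    (h0 : ∀ x, |h 0 x| ≤ L₀) (hR : E 0 + K * T < R) (hL : L₀ + K₂ * T + η * R < L) :
    ∀ t ∈ Icc 0 T, (∀ x, |h t x| ≤ L) ∧ E t ≤ R := by
  have hred : ∀ t x, h t x = h t (Int.fract x) := fun t =>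
    periodic_one_eq_fract (hper t)
  have hfr : ∀ x : ℝ, Int.fract x ∈ Icc (0:ℝ) 1 := fun x =>
    ⟨Int.fract_nonneg x, (Int.fract_lt_one x).le⟩
  have hall : ∀ t, (∀ x ∈ Icc (0:ℝ) 1, max (|h t x| - L) (E t - R) ≤ 0) →
      (∀ x, |h t x| ≤ L) ∧ E t ≤ R := by
    intro t hb
    refine ⟨fun x => ?_, ?_⟩
    · rw [hred]
      have := (max_le_iff.1 (hb _ (hfr x))).1
      linarith
    · have := (max_le_iff.1 (hb _ (hfr 0))).2
      linarith
  have hfst : ContinuousOn (fun p : ℝ × ℝ => E p.1) (Ici 0 ×ˢ univ) :=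
    hEc.comp continuous_fst.continuousOn fun p hp => hp.1
  have hmono : ∀ T' : ℝ, 0 ≤ T' → T' ≤ T → E 0 + K * T' < R ∧ L₀ + K₂ * T' + η * R < L := by
    intro T' _ h2
    constructor <;> nlinarith
  suffices hmain : ∀ t ∈ Icc 0 T, ∀ x ∈ Icc (0:ℝ) 1, max (|h t x| - L) (E t - R) < 0 from
    fun t ht => hall t fun x hx => (hmain t ht x hx).le
  have hstep : ∀ t ∈ Icc 0 T,
      (∀ s ∈ Ioc 0 t, ∀ x ∈ Icc (0:ℝ) 1, max (|h s x| - L) (E s - R) ≤ 0) →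
      ∀ x ∈ Icc (0:ℝ) 1, max (|h t x| - L) (E t - R) < 0 := by
    intro t htT hb x _
    have hb' := fun s hs => hall s (hb s hs)
    obtain ⟨hR', hL'⟩ := hmono t htT.1 htT.2
    have hER : E t ≤ E 0 + K * t := by
      have := Convex.image_sub_le_mul_sub_of_deriv_le (convex_Icc 0 t)
        (hEc.mono fun s hs => hs.1)
        (fun s hs => by
          rw [interior_Icc] at hs
          exact (hEd s hs.1).differentiableAt.differentiableWithinAt)
        (C := K) (fun s hs => by
          rw [interior_Icc] at hs
          rw [(hEd s hs.1).deriv]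
          exact hE' s hs.1 (hb' s ⟨hs.1, hs.2.le⟩).1 (hb' s ⟨hs.1, hs.2.le⟩).2)
        0 ⟨le_rfl, htT.1⟩ t ⟨htT.1, le_rfl⟩ htT.1
      linarith
    have hside : ∀ σ : ℝ, |σ| = 1 → σ * h t x ≤ L₀ + K₂ * t + η * E 0 := by
      intro σ hσ
      have := transport_max_principle
        (f := fun s y => σ * h s y - L₀ - K₂ * s + η * (E s - E 0))
        (ft := fun s y => σ * ht s y - K₂ + η * E' s) (fx := fun s y => σ * hx s y) (u := u)
        (T := t)
        ((((continuousOn_const.mul hc).sub continuousOn_const).sub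
          (continuous_const.mul continuous_fst).continuousOn).add
          (continuousOn_const.mul (hfst.sub continuousOn_const)))
        (by simp [hper])
        (fun s hs y => by
          refine (((((hdt s hs y).const_mul σ).sub_const L₀).sub
            ((hasDerivAt_id s).const_mul K₂)).add
            (((hEd s hs).sub_const (E 0)).const_mul η)).congr_deriv (by ring))
        (fun s hs y => by
          exact ((((hdx s hs y).const_mul σ).sub_const L₀).sub_const (K₂ * s)).add_const _)
        (fun s hs y hy => by
          have h1 := hux s hs.1 (hb' s hs).1 (hb' s hs).2 y hy
          have h2 : |σ * ux s y| = |ux s y| := by rw [abs_mul, hσ, one_mul]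
          have h3 := neg_abs_le (σ * ux s y)
          have h4 := htr s hs.1 y
          have h5 : σ * ht s y - K₂ + η * E' s + u s y * (σ * hx s y)
            = -(σ * ux s y) - K₂ + η * E' s := by linear_combination σ * h4
          rw [h5]
          linarith)
        (fun y => by
          have h1 : |σ * h 0 y| = |h 0 y| := by rw [abs_mul, hσ, one_mul]
          have h2 := le_abs_self (σ * h 0 y)
          have h3 := h0 y
          simp only [mul_zero, sub_self]
          linarith)
        t ⟨htT.1, le_rfl⟩ x
      have hEt := mul_nonneg hη (hE0 t)
      linarith
    have hE0R : η * E 0 ≤ η * R := by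
      refine mul_le_mul_of_nonneg_left ?_ hη
      have := mul_nonneg hK htT.1
      linarith
    have h1 := hside 1 (by simp)
    have h2 := hside (-1) (by simp)
    refine max_lt ?_ (by linarith)
    have : |h t x| ≤ L₀ + K₂ * t + η * E 0 := abs_le.2 ⟨by linarith, by linarith⟩
    linarith
  refine fun t ht => ?_
  have hT : 0 ≤ T := ht.1.trans ht.2
  refine lt_zero_of_forall_le_imp_lt_zero ?_ ?_ (fun t ht hb => hstep t ht fun s hs => ?_) t ht
  · exact ((hc.abs.sub continuousOn_const).sup (hfst.sub continuousOn_const)).mono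
      (prod_mono (fun s hs => hs.1) (subset_univ _))
  · exact hstep 0 ⟨le_rfl, hT⟩ fun s hs => absurd hs.1 (not_lt.2 hs.2)
  · exact hb s ⟨hs.1.le, hs.2⟩

/-- The spatial profiles, at a fixed positive time, of a solution of the non-local
Navier–Stokes–Korteweg system with density `r ∈ [N⁻¹, N]`, velocity `v`, order parameter `c` and
artificial pressure `q`, together with their derivatives; `p` is the derivative of the artificial
pressure with respect to the density. -/
structure IsNSKProfile (μ κ γ N Q : ℝ)
    (r rx rt v vx vxx vt vtx c cx cxx q p : ℝ → ℝ) : Prop where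
  hasDerivAt_v : ∀ x, HasDerivAt v (vx x) x
  hasDerivAt_vx : ∀ x, HasDerivAt vx (vxx x) x
  hasDerivAt_vt : ∀ x, HasDerivAt vt (vtx x) x
  hasDerivAt_c : ∀ x, HasDerivAt c (cx x) x
  hasDerivAt_cx : ∀ x, HasDerivAt cx (cxx x) x
  hasDerivAt_q : ∀ x, HasDerivAt q (p x * rx x) x
  continuous_r : Continuous r
  continuous_rx : Continuous rx
  continuous_rt : Continuous rt
  continuous_vxx : Continuous vxx
  continuous_vtx : Continuous vtx
  continuous_cxx : Continuous cxx
  continuous_p : Continuous p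
  v_one : v 1 = v 0
  vx_one : vx 1 = vx 0
  vt_one : vt 1 = vt 0
  c_one : c 1 = c 0
  cx_one : cx 1 = cx 0
  q_one : q 1 = q 0
  mass : ∀ x, rt x + rx x * v x + r x * vx x = 0
  momentum : ∀ x, r x * (vt x + v x * vx x) = μ * vxx x - p x * rx x + γ * r x * cx x
  elliptic : ∀ x, κ * cxx x = γ * (c x - r x)
  le_r : ∀ x, N⁻¹ ≤ r x
  r_le : ∀ x, r x ≤ N
  abs_q_le : ∀ x, |q x| ≤ Q
  abs_p_mul_r_le : ∀ x, |p x * r x| ≤ Q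

namespace IsNSKProfile

variable {μ κ γ N Q : ℝ} {r rx rt v vx vxx vt vtx c cx cxx q p : ℝ → ℝ}

lemma hasDerivAt_flux (h : IsNSKProfile μ κ γ N Q r rx rt v vx vxx vt vtx c cx cxx q p) (x : ℝ) :
    HasDerivAt (fun y => μ * vx y - q y) (μ * vxx x - p x * rx x) x :=
  ((h.hasDerivAt_vx x).const_mul μ).sub (h.hasDerivAt_q x)

lemma continuous_v (h : IsNSKProfile μ κ γ N Q r rx rt v vx vxx vt vtx c cx cxx q p) :
    Continuous v :=
  continuous_iff_continuousAt.2 fun x => (h.hasDerivAt_v x).continuousAt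

lemma continuous_vx (h : IsNSKProfile μ κ γ N Q r rx rt v vx vxx vt vtx c cx cxx q p) :
    Continuous vx :=
  continuous_iff_continuousAt.2 fun x => (h.hasDerivAt_vx x).continuousAt

lemma continuous_vt (h : IsNSKProfile μ κ γ N Q r rx rt v vx vxx vt vtx c cx cxx q p) :
    Continuous vt :=
  continuous_iff_continuousAt.2 fun x => (h.hasDerivAt_vt x).continuousAt

lemma continuous_c (h : IsNSKProfile μ κ γ N Q r rx rt v vx vxx vt vtx c cx cxx q p) :
    Continuous c :=
  continuous_iff_continuousAt.2 fun x => (h.hasDerivAt_c x).continuousAt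

lemma continuous_cx (h : IsNSKProfile μ κ γ N Q r rx rt v vx vxx vt vtx c cx cxx q p) :
    Continuous cx :=
  continuous_iff_continuousAt.2 fun x => (h.hasDerivAt_cx x).continuousAt

lemma continuous_q (h : IsNSKProfile μ κ γ N Q r rx rt v vx vxx vt vtx c cx cxx q p) :
    Continuous q :=
  continuous_iff_continuousAt.2 fun x => (h.hasDerivAt_q x).continuousAt

lemma continuous_deriv_flux (h : IsNSKProfile μ κ γ N Q r rx rt v vx vxx vt vtx c cx cxx q p) :
    Continuous fun x => μ * vxx x - p x * rx x :=
  (continuous_const.mul h.continuous_vxx).sub (h.continuous_p.mul h.continuous_rx)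

lemma abs_flux_le (h : IsNSKProfile μ κ γ N Q r rx rt v vx vxx vt vtx c cx cxx q p)
    {θ : ℝ} (hθ : 0 < θ) {x : ℝ} (hx : x ∈ Icc (0:ℝ) 1) :
    |μ * vx x - q x| ≤
      Q + (1 / (4 * θ) + θ * ∫ y in (0:ℝ)..1, (μ * vxx y - p y * rx y) ^ 2) := by
  refine abs_le_of_abs_integral_le h.hasDerivAt_flux h.continuous_deriv_flux ?_ hθ hx
  rw [intervalIntegral.integral_sub (f := fun y => μ * vx y)
    ((continuous_const.mul h.continuous_vx).intervalIntegrable _ _)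
    (h.continuous_q.intervalIntegrable _ _), intervalIntegral.integral_const_mul,
    intervalIntegral.integral_eq_sub_of_hasDerivAt (fun z _ => h.hasDerivAt_v z)
      (h.continuous_vx.intervalIntegrable _ _), h.v_one]
  simpa using intervalIntegral.norm_integral_le_of_norm_le_const (a := (0:ℝ)) (b := 1) (C := Q)
    (f := q) fun y _ => h.abs_q_le y

set_option maxHeartbeats 400000 in
/-- The pointwise form of the effective-viscous-flux estimate, before integration by parts. -/
lemma flux_dissipation_pointwise
    (h : IsNSKProfile μ κ γ N Q r rx rt v vx vxx vt vtx c cx cxx q p)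
    (hμ : 0 < μ) (hκ : 0 < κ) (hγ : 0 < γ) (hN : 0 < N) {m B A x : ℝ}
    (hA : A = 2 * N * μ * γ ^ 2) (hB : |μ * vx x - q x| ≤ B) :
    (μ * vx x - q x) * (μ * vtx x - p x * rt x) + m * vt x ≤
      (μ * ((μ * vxx x - p x * rx x) * vt x + (μ * vx x - q x) * vtx x)
        + (vx x * ((μ * vx x - q x) ^ 2 / 2 + q x * (μ * vx x - q x))
          + v x * ((μ * vx x - q x) * (μ * vxx x - p x * rx x)
            + (p x * rx x * (μ * vx x - q x) + q x * (μ * vxx x - p x * rx x))))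
        + m * (γ * cx x - v x * vx x)
        + A * (cx x * cx x + c x * cxx x))
      + (-(3 * μ / (4 * N)) * (μ * vxx x - p x * rx x) ^ 2
        + ((B + Q) / (2 * μ) + 4 * Q / μ) * (μ * vx x - q x) ^ 2
        + (A * (γ * N ^ 2 / (4 * κ)) + 2 * N ^ 3 / μ * m ^ 2 + 2 * Q ^ 3 / μ)) := by
  have hmass := h.mass x
  have hmom := h.momentum x
  have hell := h.elliptic x
  have hle := h.le_r x
  have hge := h.r_le x
  have hq := h.abs_q_le x
  have hpr := h.abs_p_mul_r_le x
  have hvx : vx x = ((μ * vx x - q x) + q x) / μ := by field_simp; ring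
  have hSx : μ * vxx x - p x * rx x = r x * (vt x + v x * vx x - γ * cx x) := by
    linear_combination -hmom
  have hrt : rt x = -(rx x * v x) - r x * vx x := by linear_combination hmass
  set S := μ * vx x - q x with hS
  set D := μ * vxx x - p x * rx x with hD
  have hr : 0 < r x := lt_of_lt_of_le (inv_pos.2 hN) hle
  set w := vt x + v x * vx x - γ * cx x with hw
  have hwD : w = D / r x := by rw [hSx]; field_simp
  have hQ : 0 ≤ Q := (abs_nonneg _).trans hq
  have e1 : S * (μ * vtx x - p x * rt x) + m * vt x
      = (μ * (D * vt x + S * vtx x)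
        + (vx x * (S ^ 2 / 2 + q x * S) + v x * (S * D + (p x * rx x * S + q x * D)))
        + m * (γ * cx x - v x * vx x))
      + (-μ * (D * w) - μ * γ * D * cx x + m * w - vx x * (S ^ 2 / 2)
        + S * vx x * (p x * r x - q x)) := by
    rw [hrt, hw]
    have : S = μ * vx x - q x := hS
    linear_combination (-(v x * D)) * this
  clear_value S D w
  have b1 : D ^ 2 / N ≤ D * w := by
    rw [hwD, mul_div_assoc', ← sq]
    exact div_le_div_of_nonneg_left (sq_nonneg D) hr hge
  have b2 : -(μ * γ * D * cx x) ≤ μ / (8 * N) * D ^ 2 + A * cx x ^ 2 := by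
    have : μ / (8 * N) * D ^ 2 + A * cx x ^ 2 + μ * γ * D * cx x
        = μ / (8 * N) * (D + 4 * N * γ * cx x) ^ 2 := by rw [hA]; field_simp; ring
    have h2 : 0 ≤ μ / (8 * N) * (D + 4 * N * γ * cx x) ^ 2 := by positivity
    linarith
  have b3 : m * w ≤ μ / (8 * N) * D ^ 2 + 2 * N ^ 3 / μ * m ^ 2 := by
    have h1 : w ^ 2 ≤ (N * D) ^ 2 := by
      have : |w| ≤ |N * D| := by
        rw [hwD, abs_div, abs_mul, abs_of_pos hr, abs_of_pos hN, div_le_iff₀ hr]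
        have : 1 ≤ N * r x := by
          rw [inv_le_iff_one_le_mul₀ hN] at hle; linarith
        nlinarith [abs_nonneg D]
      exact sq_le_sq.2 this
    have h2 : μ / (8 * N ^ 3) * w ^ 2 + 2 * N ^ 3 / μ * m ^ 2 - m * w
        = (μ * w - 4 * N ^ 3 * m) ^ 2 / (8 * N ^ 3 * μ) := by field_simp; ring
    have h3 : 0 ≤ (μ * w - 4 * N ^ 3 * m) ^ 2 / (8 * N ^ 3 * μ) := by positivity
    have h4 : μ / (8 * N ^ 3) * w ^ 2 ≤ μ / (8 * N ^ 3) * (N * D) ^ 2 :=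
      mul_le_mul_of_nonneg_left h1 (by positivity)
    have h5 : μ / (8 * N ^ 3) * (N * D) ^ 2 = μ / (8 * N) * D ^ 2 := by field_simp
    linarith
  have b4 : -(vx x * (S ^ 2 / 2)) ≤ (B + Q) / (2 * μ) * S ^ 2 := by
    have h1 : -(S + q x) ≤ B + Q := by
      have := neg_abs_le S; have := neg_abs_le (q x); linarith
    have h2 : -(vx x * (S ^ 2 / 2)) = (-(S + q x)) * (S ^ 2 / (2 * μ)) := by
      rw [hvx]; field_simp
    have h3 : (B + Q) / (2 * μ) * S ^ 2 = (B + Q) * (S ^ 2 / (2 * μ)) := by ring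
    rw [h2, h3]
    exact mul_le_mul_of_nonneg_right h1 (by positivity)
  have b5 : S * vx x * (p x * r x - q x) ≤ 4 * Q / μ * S ^ 2 + 2 * Q ^ 3 / μ := by
    have h1 : |S * (S + q x)| ≤ 2 * S ^ 2 + Q ^ 2 := by
      rw [abs_mul]
      have := abs_add_le S (q x)
      have h2 : |S| * |S + q x| ≤ |S| * (|S| + Q) :=
        mul_le_mul_of_nonneg_left (by linarith) (abs_nonneg S)
      nlinarith [sq_abs S, sq_nonneg (|S| - Q)]
    have h2 : |p x * r x - q x| ≤ 2 * Q := by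
      have := abs_sub (p x * r x) (q x); linarith
    have h3 : S * (S + q x) * (p x * r x - q x) ≤ (2 * S ^ 2 + Q ^ 2) * (2 * Q) := by
      refine (le_abs_self _).trans ?_
      rw [abs_mul]
      exact mul_le_mul h1 h2 (abs_nonneg _) (by positivity)
    have h4 : S * vx x * (p x * r x - q x) = S * (S + q x) * (p x * r x - q x) / μ := by
      rw [hvx]; field_simp
    rw [h4, div_le_iff₀ hμ]
    refine h3.trans (le_of_eq ?_)
    field_simp
    ring
  have b6 : A * cx x ^ 2 ≤ A * (cx x * cx x + c x * cxx x) + A * (γ * N ^ 2 / (4 * κ)) := by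
    have h1 : c x * cxx x = γ / κ * (c x * (c x - r x)) := by
      field_simp
      linear_combination c x * hell
    have h2 : γ / κ * (c x * (c x - r x)) + γ * N ^ 2 / (4 * κ)
        = γ / κ * ((c x - r x / 2) ^ 2 + (N ^ 2 - r x ^ 2) / 4) := by field_simp; ring
    have h3 : 0 ≤ γ / κ * ((c x - r x / 2) ^ 2 + (N ^ 2 - r x ^ 2) / 4) := by
      have : r x ^ 2 ≤ N ^ 2 := pow_le_pow_left₀ hr.le hge 2
      have h4 : 0 ≤ N ^ 2 - r x ^ 2 := by linarith
      positivity
    have hA0 : 0 ≤ A := by rw [hA]; positivity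
    rw [← mul_add]
    refine mul_le_mul_of_nonneg_left ?_ hA0
    rw [h1, ← sq]
    linarith
  have b7 : -μ * (D * w) ≤ -μ * (D ^ 2 / N) := by
    have := mul_le_mul_of_nonneg_left b1 hμ.le
    linarith
  have b8 : -μ * (D ^ 2 / N) + μ / (8 * N) * D ^ 2 + μ / (8 * N) * D ^ 2
      = -(3 * μ / (4 * N)) * D ^ 2 := by field_simp; ring
  rw [e1]
  linarith

/-- The time derivative of the flux energy is controlled up to the dissipation. -/
lemma flux_dissipation
    (h : IsNSKProfile μ κ γ N Q r rx rt v vx vxx vt vtx c cx cxx q p)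
    (hμ : 0 < μ) (hκ : 0 < κ) (hγ : 0 < γ) (hN : 0 < N) {R : ℝ} (hR : 0 < R)
    (hY : ∫ x in (0:ℝ)..1, (μ * vx x - q x) ^ 2 ≤ 2 * R) (hm : (∫ x in (0:ℝ)..1, v x) ^ 2 ≤ 2 * R) :
    (∫ x in (0:ℝ)..1, (μ * vx x - q x) * (μ * vtx x - p x * rt x))
        + (∫ x in (0:ℝ)..1, v x) * ∫ x in (0:ℝ)..1, vt x ≤
      (2 * Q + N * R / μ ^ 2) * R / μ + 8 * Q * R / μ
        + (2 * N * μ * γ ^ 2 * (γ * N ^ 2 / (4 * κ)) + 4 * N ^ 3 / μ * R + 2 * Q ^ 3 / μ)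
        - μ / (2 * N) * ∫ x in (0:ℝ)..1, (μ * vxx x - p x * rx x) ^ 2 := by
  set D := ∫ x in (0:ℝ)..1, (μ * vxx x - p x * rx x) ^ 2 with hD
  set Y := ∫ x in (0:ℝ)..1, (μ * vx x - q x) ^ 2 with hYdef
  set m := ∫ x in (0:ℝ)..1, v x with hmdef
  set θ := μ ^ 2 / (4 * N * R) with hθ
  set B := Q + (1 / (4 * θ) + θ * D) with hB
  set A := 2 * N * μ * γ ^ 2 with hA
  set k := A * (γ * N ^ 2 / (4 * κ)) + 2 * N ^ 3 / μ * m ^ 2 + 2 * Q ^ 3 / μ with hk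
  set b := (B + Q) / (2 * μ) + 4 * Q / μ with hb
  have hθ0 : 0 < θ := by positivity
  have hQ : 0 ≤ Q := (abs_nonneg _).trans (h.abs_q_le 0)
  have hD0 : 0 ≤ D := intervalIntegral.integral_nonneg zero_le_one fun x _ => sq_nonneg _
  have hb0 : 0 ≤ b := by positivity
  have cr := h.continuous_r
  have crx := h.continuous_rx
  have crt := h.continuous_rt
  have cv := h.continuous_v
  have cvx := h.continuous_vx
  have cvxx := h.continuous_vxx
  have cvt := h.continuous_vt
  have cvtx := h.continuous_vtx
  have cc := h.continuous_c
  have ccx := h.continuous_cx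
  have ccxx := h.continuous_cxx
  have cq := h.continuous_q
  have cp := h.continuous_p
  set G : ℝ → ℝ := fun x => μ * ((μ * vx x - q x) * vt x)
    + v x * ((μ * vx x - q x) ^ 2 / 2 + q x * (μ * vx x - q x))
    + m * (γ * c x - v x ^ 2 / 2) + A * (c x * cx x) with hG
  set G' : ℝ → ℝ := fun x =>
    μ * ((μ * vxx x - p x * rx x) * vt x + (μ * vx x - q x) * vtx x)
        + (vx x * ((μ * vx x - q x) ^ 2 / 2 + q x * (μ * vx x - q x))
          + v x * ((μ * vx x - q x) * (μ * vxx x - p x * rx x)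
            + (p x * rx x * (μ * vx x - q x) + q x * (μ * vxx x - p x * rx x))))
        + m * (γ * cx x - v x * vx x)
        + A * (cx x * cx x + c x * cxx x) with hG'
  have hGd : ∀ x, HasDerivAt G (G' x) x := by
    intro x
    have hS := h.hasDerivAt_flux x
    refine ((((hS.mul (h.hasDerivAt_vt x)).const_mul μ).add ((h.hasDerivAt_v x).mul
      (((hS.pow 2).div_const 2).add ((h.hasDerivAt_q x).mul hS)))).add
      ((((h.hasDerivAt_c x).const_mul γ).sub (((h.hasDerivAt_v x).pow 2).div_const 2)).const_mul
        m)).add (((h.hasDerivAt_c x).mul (h.hasDerivAt_cx x)).const_mul A) |>.congr_deriv ?_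
    simp only [hG', Pi.pow_apply, Pi.mul_apply, Pi.add_apply]
    ring
  have cG' : Continuous G' := by fun_prop
  have hG0 : ∫ x in (0:ℝ)..1, G' x = 0 := by
    rw [intervalIntegral.integral_eq_sub_of_hasDerivAt (fun x _ => hGd x)
      (cG'.intervalIntegrable _ _)]
    simp only [hG, h.v_one, h.vx_one, h.vt_one, h.c_one, h.cx_one, h.q_one, sub_self]
  have hlhs : (∫ x in (0:ℝ)..1, (μ * vx x - q x) * (μ * vtx x - p x * rt x))
      + m * ∫ x in (0:ℝ)..1, vt x
      = ∫ x in (0:ℝ)..1, ((μ * vx x - q x) * (μ * vtx x - p x * rt x) + m * vt x) := by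
    rw [intervalIntegral.integral_add (Continuous.intervalIntegrable (by fun_prop) _ _)
      (Continuous.intervalIntegrable (by fun_prop) _ _), intervalIntegral.integral_const_mul]
  have hrhs : ∫ x in (0:ℝ)..1, (G' x + (-(3 * μ / (4 * N)) * (μ * vxx x - p x * rx x) ^ 2
        + b * (μ * vx x - q x) ^ 2 + k)) = -(3 * μ / (4 * N)) * D + b * Y + k := by
    rw [intervalIntegral.integral_add (cG'.intervalIntegrable _ _)
        (Continuous.intervalIntegrable (by fun_prop) _ _), hG0,
      intervalIntegral.integral_add (Continuous.intervalIntegrable (by fun_prop) _ _) (by simp),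
      intervalIntegral.integral_add (Continuous.intervalIntegrable (by fun_prop) _ _)
        (Continuous.intervalIntegrable (by fun_prop) _ _),
      intervalIntegral.integral_const_mul, intervalIntegral.integral_const_mul]
    simp [hD, hYdef]
  have hmono : ∫ x in (0:ℝ)..1, ((μ * vx x - q x) * (μ * vtx x - p x * rt x) + m * vt x) ≤
      ∫ x in (0:ℝ)..1, (G' x + (-(3 * μ / (4 * N)) * (μ * vxx x - p x * rx x) ^ 2
        + b * (μ * vx x - q x) ^ 2 + k)) :=
    intervalIntegral.integral_mono_on zero_le_one
      (Continuous.intervalIntegrable (by fun_prop) _ _)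
      (Continuous.intervalIntegrable (by fun_prop) _ _) fun x hx =>
        h.flux_dissipation_pointwise hμ hκ hγ hN hA (h.abs_flux_le hθ0 hx)
  rw [hlhs]
  refine hmono.trans ?_
  rw [hrhs]
  have h1 : b * Y ≤ b * (2 * R) := mul_le_mul_of_nonneg_left hY hb0
  have h2 : b * (2 * R) = (2 * Q + N * R / μ ^ 2) * R / μ + 8 * Q * R / μ + μ / (4 * N) * D := by
    rw [hb, hB, hθ]; field_simp; ring
  have h3 : 2 * N ^ 3 / μ * m ^ 2 ≤ 2 * N ^ 3 / μ * (2 * R) :=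
    mul_le_mul_of_nonneg_left hm (by positivity)
  have h4 : -(3 * μ / (4 * N)) * D + μ / (4 * N) * D = -(μ / (2 * N) * D) := by field_simp; ring
  have h5 : 2 * N ^ 3 / μ * (2 * R) = 4 * N ^ 3 / μ * R := by ring
  rw [hk]
  clear_value b D Y m A
  linarith only [h1, h2, h3, h4, h5]

end IsNSKProfile

lemma continuous_slice {F : ℝ → ℝ → ℝ}
    (hF : ContDiffOn ℝ ∞ (fun p : ℝ × ℝ => F p.1 p.2) (Ici 0 ×ˢ univ)) {t : ℝ} (ht : 0 ≤ t) :
    Continuous (F t) :=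
  continuous_iff_continuousAt.2 fun x => (differentiableAt_space hF ht x).continuousAt

lemma differentiable_deriv_time {F : ℝ → ℝ → ℝ}
    (hF : ContDiffOn ℝ ∞ (fun p : ℝ × ℝ => F p.1 p.2) (Ici 0 ×ˢ univ)) {t : ℝ} (ht : 0 < t) :
    Differentiable ℝ fun x => deriv (fun s => F s x) t := fun x =>
  (hasDerivAt_space' (F := fun t x => deriv (fun s => F s x) t)
    ((contDiffAt_deriv_time hF ht x).differentiableAt (by simp))).differentiableAt

lemma continuousOn_deriv_time {F : ℝ → ℝ → ℝ}
    (hF : ContDiffOn ℝ ∞ (fun p : ℝ × ℝ => F p.1 p.2) (Ici 0 ×ˢ univ)) :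
    ContinuousOn (fun p : ℝ × ℝ => deriv (fun s => F s p.2) p.1) (Ioi 0 ×ˢ univ) := fun p hp =>
  (contDiffAt_deriv_time hF hp.1 p.2).continuousAt.continuousWithinAt

lemma deriv_periodic_one {f : ℝ → ℝ} (hf : ∀ x, f (x + 1) = f x) (x : ℝ) :
    deriv f (x + 1) = deriv f x := by
  rw [← deriv_comp_add_const, funext hf]

section Pressure

variable {P : ℝ → ℝ} {γ : ℝ}

lemma hasDerivAt_artificialPressure (hP : ContDiffOn ℝ 1 P (Ici 0)) {r : ℝ} (hr : 0 < r) :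
    HasDerivAt (artificialPressure P γ) (deriv P r + γ * r) r := by
  have h1 : HasDerivAt P (deriv P r) r :=
    ((hP.contDiffAt (Ici_mem_nhds hr)).differentiableAt (by simp)).hasDerivAt
  refine (h1.add (((hasDerivAt_id r).pow 2).const_mul (γ / 2))).congr_deriv ?_
  simp only [id, Nat.cast_ofNat]
  ring

lemma continuousOn_deriv_artificialPressure (hP : ContDiffOn ℝ 1 P (Ici 0)) :
    ContinuousOn (fun r => deriv P r + γ * r) (Ioi 0) :=
  ((hP.mono Ioi_subset_Ici_self).continuousOn_deriv_of_isOpen isOpen_Ioi le_rfl).add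
    (continuousOn_const.mul continuousOn_id)

lemma continuousOn_artificialPressure (hP : ContDiffOn ℝ 1 P (Ici 0)) :
    ContinuousOn (artificialPressure P γ) (Ioi 0) := fun _ hr =>
  (hasDerivAt_artificialPressure hP hr).continuousAt.continuousWithinAt

lemma exists_pressure_bound (hP : ContDiffOn ℝ 1 P (Ici 0)) {N : ℝ} (hN : 0 < N) :
    ∃ Q, 0 < Q ∧ ∀ r, N⁻¹ ≤ r → r ≤ N →
      |artificialPressure P γ r| ≤ Q ∧ |(deriv P r + γ * r) * r| ≤ Q := by
  have hsub : Icc N⁻¹ N ⊆ Ioi 0 := fun r hr => lt_of_lt_of_le (inv_pos.2 hN) hr.1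
  obtain ⟨Q₁, h₁⟩ := isCompact_Icc.exists_bound_of_continuousOn
    ((continuousOn_artificialPressure (γ := γ) hP).mono hsub)
  obtain ⟨Q₂, h₂⟩ := isCompact_Icc.exists_bound_of_continuousOn
    (((continuousOn_deriv_artificialPressure (γ := γ) hP).mul continuousOn_id).mono hsub)
  refine ⟨max 1 (max Q₁ Q₂), by positivity, fun r h h' => ⟨?_, ?_⟩⟩
  · exact (h₁ r ⟨h, h'⟩).trans ((le_max_left _ _).trans (le_max_right _ _))
  · exact (h₂ r ⟨h, h'⟩).trans ((le_max_right _ _).trans (le_max_right _ _))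

end Pressure

/-- The effective viscous flux `Σ = μ ∂ₓu − P_γ(ρ)`. -/
noncomputable def viscousFlux (μ γ : ℝ) (P : ℝ → ℝ) (ρ u : ℝ → ℝ → ℝ) (t x : ℝ) : ℝ :=
  μ * deriv (u t) x - artificialPressure P γ (ρ t x)

/-- The time derivative of the effective viscous flux. -/
noncomputable def viscousFluxDt (μ γ : ℝ) (P : ℝ → ℝ) (ρ u : ℝ → ℝ → ℝ) (t x : ℝ) : ℝ :=
  μ * deriv (fun s => deriv (u s) x) t
    - (deriv P (ρ t x) + γ * ρ t x) * deriv (fun s => ρ s x) t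

/-- Half the squared `L²` norm of the effective viscous flux plus half the squared mean velocity. -/
noncomputable def fluxEnergy (μ γ : ℝ) (P : ℝ → ℝ) (ρ u : ℝ → ℝ → ℝ) (t : ℝ) : ℝ :=
  (∫ x in (0:ℝ)..1, viscousFlux μ γ P ρ u t x ^ 2) / 2 + (∫ x in (0:ℝ)..1, u t x) ^ 2 / 2

/-- The time derivative of `fluxEnergy`. -/
noncomputable def fluxEnergyDt (μ γ : ℝ) (P : ℝ → ℝ) (ρ u : ℝ → ℝ → ℝ) (t : ℝ) : ℝ :=
  (∫ x in (0:ℝ)..1, viscousFlux μ γ P ρ u t x * viscousFluxDt μ γ P ρ u t x)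
    + (∫ x in (0:ℝ)..1, u t x) * ∫ x in (0:ℝ)..1, deriv (fun s => u s x) t

lemma fluxEnergy_nonneg (μ γ : ℝ) (P : ℝ → ℝ) (ρ u : ℝ → ℝ → ℝ) (t : ℝ) :
    0 ≤ fluxEnergy μ γ P ρ u t := by
  have : 0 ≤ ∫ x in (0:ℝ)..1, viscousFlux μ γ P ρ u t x ^ 2 :=
    intervalIntegral.integral_nonneg zero_le_one fun x _ => sq_nonneg _
  unfold fluxEnergy
  positivity

namespace IsNSKSolution

variable {μ κ γ : ℝ} {P : ℝ → ℝ} {ρ u c : ℝ → ℝ → ℝ} {ρ₀ u₀ : ℝ → ℝ}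

lemma continuousOn_viscousFlux (h : IsNSKSolution μ κ γ P (Ici 0) ρ u c ρ₀ u₀)
    (hP : ContDiffOn ℝ 1 P (Ici 0)) :
    ContinuousOn (fun p : ℝ × ℝ => viscousFlux μ γ P ρ u p.1 p.2) (Ici 0 ×ˢ univ) :=
  (continuousOn_const.mul (contDiffOn_deriv_space h.smooth_u).continuousOn).sub
    ((continuousOn_artificialPressure hP).comp h.smooth_rho.continuousOn
      fun p _ => h.rho_pos p.1 p.2)

lemma hasDerivAt_viscousFlux_time (h : IsNSKSolution μ κ γ P (Ici 0) ρ u c ρ₀ u₀)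
    (hP : ContDiffOn ℝ 1 P (Ici 0)) {t : ℝ} (ht : 0 < t) (x : ℝ) :
    HasDerivAt (fun s => viscousFlux μ γ P ρ u s x) (viscousFluxDt μ γ P ρ u t x) t :=
  ((differentiableAt_time (contDiffOn_deriv_space h.smooth_u) ht x).hasDerivAt.const_mul μ).sub
    ((hasDerivAt_artificialPressure hP (h.rho_pos t x)).comp (h := fun s => ρ s x) t
      (differentiableAt_time h.smooth_rho ht x).hasDerivAt)

lemma continuousOn_viscousFluxDt (h : IsNSKSolution μ κ γ P (Ici 0) ρ u c ρ₀ u₀)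
    (hP : ContDiffOn ℝ 1 P (Ici 0)) :
    ContinuousOn (fun p : ℝ × ℝ => viscousFluxDt μ γ P ρ u p.1 p.2) (Ioi 0 ×ˢ univ) := by
  refine (continuousOn_const.mul
    (continuousOn_deriv_time (contDiffOn_deriv_space h.smooth_u))).sub
    (ContinuousOn.mul ?_ (continuousOn_deriv_time h.smooth_rho))
  exact (continuousOn_deriv_artificialPressure hP).comp
    (h.smooth_rho.continuousOn.mono (prod_mono Ioi_subset_Ici_self subset_rfl))
    fun p _ => h.rho_pos p.1 p.2

lemma continuousOn_fluxEnergy (h : IsNSKSolution μ κ γ P (Ici 0) ρ u c ρ₀ u₀)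
    (hP : ContDiffOn ℝ 1 P (Ici 0)) :
    ContinuousOn (fluxEnergy μ γ P ρ u) (Ici 0) :=
  ((continuousOn_integral_unit ((h.continuousOn_viscousFlux hP).pow 2)).div_const 2).add
    (((continuousOn_integral_unit h.smooth_u.continuousOn).pow 2).div_const 2)

lemma hasDerivAt_fluxEnergy (h : IsNSKSolution μ κ γ P (Ici 0) ρ u c ρ₀ u₀)
    (hP : ContDiffOn ℝ 1 P (Ici 0)) {t : ℝ} (ht : 0 < t) :
    HasDerivAt (fluxEnergy μ γ P ρ u) (fluxEnergyDt μ γ P ρ u t) t := by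
  have hsub : Ioi (0:ℝ) ×ˢ (univ : Set ℝ) ⊆ Ici 0 ×ˢ univ :=
    prod_mono Ioi_subset_Ici_self subset_rfl
  have hS := (h.continuousOn_viscousFlux hP).mono hsub
  have h1 := hasDerivAt_integral_unit (F := fun t x => viscousFlux μ γ P ρ u t x ^ 2)
    (F' := fun t x => 2 * (viscousFlux μ γ P ρ u t x * viscousFluxDt μ γ P ρ u t x))
    (hS.pow 2) (continuousOn_const.mul (hS.mul (h.continuousOn_viscousFluxDt hP)))
    (fun t ht x => ((h.hasDerivAt_viscousFlux_time hP ht x).pow 2).congr_deriv (by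
      simp only [Nat.cast_ofNat]; ring)) ht
  have h2 := hasDerivAt_integral_unit (F := u) (F' := fun t x => deriv (fun s => u s x) t)
    (h.smooth_u.continuousOn.mono hsub) (continuousOn_deriv_time h.smooth_u)
    (fun t ht x => (differentiableAt_time h.smooth_u ht x).hasDerivAt) ht
  refine ((h1.div_const 2).add ((h2.pow 2).div_const 2)).congr_deriv ?_
  rw [intervalIntegral.integral_const_mul, fluxEnergyDt]
  simp only [Nat.cast_ofNat]
  ring

lemma isNSKProfile (h : IsNSKSolution μ κ γ P (Ici 0) ρ u c ρ₀ u₀)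
    (hP : ContDiffOn ℝ 1 P (Ici 0)) {t : ℝ} (ht : 0 < t) {N Q : ℝ}
    (hQ : ∀ r, N⁻¹ ≤ r → r ≤ N →
      |artificialPressure P γ r| ≤ Q ∧ |(deriv P r + γ * r) * r| ≤ Q)
    (hρ : ∀ x, N⁻¹ ≤ ρ t x ∧ ρ t x ≤ N) :
    IsNSKProfile μ κ γ N Q (ρ t) (deriv (ρ t)) (fun x => deriv (fun s => ρ s x) t) (u t)
      (deriv (u t)) (deriv (deriv (u t))) (fun x => deriv (fun s => u s x) t)
      (fun x => deriv (fun s => deriv (u s) x) t) (c t) (deriv (c t)) (deriv (deriv (c t)))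
      (fun x => artificialPressure P γ (ρ t x)) (fun x => deriv P (ρ t x) + γ * ρ t x) := by
  have hux := contDiffOn_deriv_space h.smooth_u
  have hcx := contDiffOn_deriv_space h.smooth_c
  have hrx := contDiffOn_deriv_space h.smooth_rho
  have dr : ∀ x, HasDerivAt (ρ t) (deriv (ρ t) x) x := fun x =>
    (differentiableAt_space h.smooth_rho ht.le x).hasDerivAt
  have du : ∀ x, HasDerivAt (u t) (deriv (u t) x) x := fun x =>
    (differentiableAt_space h.smooth_u ht.le x).hasDerivAt
  have dc : ∀ x, HasDerivAt (c t) (deriv (c t) x) x := fun x =>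
    (differentiableAt_space h.smooth_c ht.le x).hasDerivAt
  have drt : ∀ x, HasDerivAt (fun s => ρ s x) (deriv (fun s => ρ s x) t) t := fun x =>
    (differentiableAt_time h.smooth_rho ht x).hasDerivAt
  have dut : ∀ x, HasDerivAt (fun s => u s x) (deriv (fun s => u s x) t) t := fun x =>
    (differentiableAt_time h.smooth_u ht x).hasDerivAt
  have dp : ∀ x, HasDerivAt P (deriv P (ρ t x)) (ρ t x) := fun x =>
    ((hP.contDiffAt (Ici_mem_nhds (h.rho_pos t x))).differentiableAt (by simp)).hasDerivAt
  have hmass : ∀ x, deriv (fun s => ρ s x) t + deriv (ρ t) x * u t x + ρ t x * deriv (u t) x = 0 :=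
    fun x => by
      have := h.mass t ht.le x
      rw [(show HasDerivAt (fun y => ρ t y * u t y) _ x from (dr x).mul (du x)).deriv] at this
      linarith
  refine
    { hasDerivAt_v := du
      hasDerivAt_vx := fun x =>
        (differentiableAt_space (F := fun t x => deriv (u t) x) hux ht.le x).hasDerivAt
      hasDerivAt_vt := fun x => by
        rw [deriv_deriv_comm h.smooth_u ht x]
        exact (differentiable_deriv_time h.smooth_u ht x).hasDerivAt
      hasDerivAt_c := dc
      hasDerivAt_cx := fun x =>
        (differentiableAt_space (F := fun t x => deriv (c t) x) hcx ht.le x).hasDerivAt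
      hasDerivAt_q := fun x =>
        (hasDerivAt_artificialPressure hP (h.rho_pos t x)).comp x (dr x)
      continuous_r := continuous_slice h.smooth_rho ht.le
      continuous_rx := continuous_slice (F := fun t x => deriv (ρ t) x) hrx ht.le
      continuous_rt := (differentiable_deriv_time h.smooth_rho ht).continuous
      continuous_vxx := continuous_slice (F := fun t x => deriv (deriv (u t)) x)
        (contDiffOn_deriv_space (F := fun t x => deriv (u t) x) hux) ht.le
      continuous_vtx := (differentiable_deriv_time hux ht).continuous
      continuous_cxx := continuous_slice (F := fun t x => deriv (deriv (c t)) x)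
        (contDiffOn_deriv_space (F := fun t x => deriv (c t) x) hcx) ht.le
      continuous_p := (continuousOn_deriv_artificialPressure hP).comp_continuous
        (continuous_slice h.smooth_rho ht.le) fun x => h.rho_pos t x
      v_one := by simpa using h.periodic_u t 0
      vx_one := by simpa using deriv_periodic_one (h.periodic_u t) 0
      vt_one := ?_
      c_one := by simpa using h.periodic_c t 0
      cx_one := by simpa using deriv_periodic_one (h.periodic_c t) 0
      q_one := by
        have := h.periodic_rho t 0
        rw [zero_add] at this
        rw [this]
      mass := hmass
      momentum := fun x => ?_
      elliptic := fun x => by linarith [h.elliptic t ht.le x]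
      le_r := fun x => (hρ x).1
      r_le := fun x => (hρ x).2
      abs_q_le := fun x => (hQ _ (hρ x).1 (hρ x).2).1
      abs_p_mul_r_le := fun x => (hQ _ (hρ x).1 (hρ x).2).2 }
  · have : (fun s => u s 1) = fun s => u s 0 := funext fun s => by simpa using h.periodic_u s 0
    simp only [this]
  · have := h.momentum t ht.le x
    rw [(show HasDerivAt (fun s => ρ s x * u s x) _ t from (drt x).mul (dut x)).deriv,
      (show HasDerivAt (fun y => ρ t y * u t y ^ 2) _ x from (dr x).mul ((du x).pow 2)).deriv,
      (show HasDerivAt (fun y => P (ρ t y)) _ x from (dp x).comp x (dr x)).deriv,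
      (show HasDerivAt (fun y => c t y - ρ t y) _ x from (dc x).sub (dr x)).deriv] at this
    simp only [Nat.cast_ofNat] at this
    linear_combination this - u t x * hmass x

end IsNSKSolution

lemma H1norm_sq (f : ℝ → ℝ) :
    H1norm f ^ 2 = ∫ x in (0:ℝ)..1, f x ^ 2 + deriv f x ^ 2 :=
  Real.sq_sqrt (intervalIntegral.integral_nonneg zero_le_one fun x _ => by positivity)

lemma L2norm_sq (f : ℝ → ℝ) : L2norm f ^ 2 = ∫ x in (0:ℝ)..1, f x ^ 2 :=
  Real.sq_sqrt (intervalIntegral.integral_nonneg zero_le_one fun x _ => by positivity)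

lemma sq_integral_le_integral_sq {v : ℝ → ℝ} (hv : Continuous v) :
    (∫ x in (0:ℝ)..1, v x) ^ 2 ≤ ∫ x in (0:ℝ)..1, v x ^ 2 := by
  set m := ∫ x in (0:ℝ)..1, v x with hm
  have h0 : 0 ≤ ∫ x in (0:ℝ)..1, (v x - m) ^ 2 :=
    intervalIntegral.integral_nonneg zero_le_one fun x _ => sq_nonneg _
  have h1 : ∫ x in (0:ℝ)..1, (v x - m) ^ 2
      = ∫ x in (0:ℝ)..1, (v x ^ 2 - 2 * m * v x + m ^ 2) := by
    congr 1 with x; ring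
  rw [h1, intervalIntegral.integral_add (Continuous.intervalIntegrable (by fun_prop) _ _)
      (by simp), intervalIntegral.integral_sub (Continuous.intervalIntegrable (by fun_prop) _ _)
      (Continuous.intervalIntegrable (by fun_prop) _ _), intervalIntegral.integral_const_mul,
    ← hm] at h0
  simp only [intervalIntegral.integral_const, sub_zero, one_smul] at h0
  linarith

lemma flux_energy_le_of_abs_le {μ Q : ℝ} {v vx q : ℝ → ℝ} (hv : Continuous v)
    (hvx : Continuous vx) (hq : Continuous q) (hQ : ∀ x, |q x| ≤ Q) :
    (∫ x in (0:ℝ)..1, (μ * vx x - q x) ^ 2) / 2 + (∫ x in (0:ℝ)..1, v x) ^ 2 / 2 ≤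
      (μ ^ 2 + 1) * (∫ x in (0:ℝ)..1, v x ^ 2 + vx x ^ 2) + Q ^ 2 := by
  have h1 : ∫ x in (0:ℝ)..1, (μ * vx x - q x) ^ 2 ≤
      ∫ x in (0:ℝ)..1, (2 * μ ^ 2 * vx x ^ 2 + 2 * Q ^ 2) := by
    refine intervalIntegral.integral_mono_on zero_le_one
      (Continuous.intervalIntegrable (by fun_prop) _ _)
      (Continuous.intervalIntegrable (by fun_prop) _ _) fun x _ => ?_
    have : q x ^ 2 ≤ Q ^ 2 := sq_le_sq' (abs_le.1 (hQ x)).1 (abs_le.1 (hQ x)).2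
    nlinarith [sq_nonneg (μ * vx x + q x)]
  rw [intervalIntegral.integral_add (Continuous.intervalIntegrable (by fun_prop) _ _)
    (by simp), intervalIntegral.integral_const_mul] at h1
  simp only [intervalIntegral.integral_const, sub_zero, one_smul] at h1
  have h2 := sq_integral_le_integral_sq hv
  rw [intervalIntegral.integral_add (Continuous.intervalIntegrable (by fun_prop) _ _)
    (Continuous.intervalIntegrable (by fun_prop) _ _)]
  have h3 : 0 ≤ ∫ x in (0:ℝ)..1, v x ^ 2 :=
    intervalIntegral.integral_nonneg zero_le_one fun x _ => sq_nonneg _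
  have h4 : 0 ≤ ∫ x in (0:ℝ)..1, vx x ^ 2 :=
    intervalIntegral.integral_nonneg zero_le_one fun x _ => sq_nonneg _
  have h5 := mul_nonneg (sq_nonneg μ) h3
  linarith

lemma integral_sq_add_sq_le_of_flux_energy_le {μ Q R : ℝ} {v vx q : ℝ → ℝ} (hμ : 0 < μ)
    (hR : 0 < R) (hv : ∀ x, HasDerivAt v (vx x) x)
    (hvx : Continuous vx) (hq : Continuous q) (hQ : ∀ x, |q x| ≤ Q)
    (hY : ∫ x in (0:ℝ)..1, (μ * vx x - q x) ^ 2 ≤ 2 * R)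
    (hm : (∫ x in (0:ℝ)..1, v x) ^ 2 ≤ 2 * R) :
    (∫ x in (0:ℝ)..1, v x ^ 2 + vx x ^ 2) ≤
      (2 + 2 * R + 2 / μ ^ 2 * (2 * R + Q ^ 2)) ^ 2 + 2 / μ ^ 2 * (2 * R + Q ^ 2) := by
  have hvc : Continuous v := continuous_iff_continuousAt.2 fun x => (hv x).continuousAt
  set B := 2 / μ ^ 2 * (2 * R + Q ^ 2) with hB
  have hB0 : 0 ≤ B := by positivity
  have h1 : ∫ x in (0:ℝ)..1, vx x ^ 2 ≤ B := by
    have h : ∫ x in (0:ℝ)..1, vx x ^ 2 ≤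
        ∫ x in (0:ℝ)..1, 2 / μ ^ 2 * ((μ * vx x - q x) ^ 2 + Q ^ 2) := by
      refine intervalIntegral.integral_mono_on zero_le_one
        (Continuous.intervalIntegrable (by fun_prop) _ _)
        (Continuous.intervalIntegrable (by fun_prop) _ _) fun x _ => ?_
      have h2 : q x ^ 2 ≤ Q ^ 2 := sq_le_sq' (abs_le.1 (hQ x)).1 (abs_le.1 (hQ x)).2
      rw [div_mul_eq_mul_div, le_div_iff₀ (by positivity)]
      nlinarith [sq_nonneg (μ * vx x - 2 * q x)]
    rw [intervalIntegral.integral_const_mul,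
      intervalIntegral.integral_add (Continuous.intervalIntegrable (by fun_prop) _ _)
        (by simp)] at h
    simp only [intervalIntegral.integral_const, sub_zero, one_smul] at h
    exact h.trans (mul_le_mul_of_nonneg_left (by linarith) (by positivity))
  have h2 : ∀ x ∈ Icc (0:ℝ) 1, v x ^ 2 ≤ (2 + 2 * R + B) ^ 2 := by
    intro x hx
    have h3 := abs_le_of_abs_integral_le hv hvx (A := 1 + 2 * R)
      (abs_le.2 ⟨by nlinarith, by nlinarith⟩) one_pos hx
    exact sq_le_sq.2 ((h3.trans (by linarith)).trans (le_abs_self _))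
  rw [intervalIntegral.integral_add (Continuous.intervalIntegrable (by fun_prop) _ _)
    (Continuous.intervalIntegrable (by fun_prop) _ _)]
  refine add_le_add ?_ h1
  calc ∫ x in (0:ℝ)..1, v x ^ 2 ≤ ∫ x in (0:ℝ)..1, (2 + 2 * R + B) ^ 2 :=
        intervalIntegral.integral_mono_on zero_le_one
          (Continuous.intervalIntegrable (by fun_prop) _ _) (by simp) h2
    _ = _ := by simp

lemma integral_dissipation_le {E E' D : ℝ → ℝ} {δ K T : ℝ} (hδ : 0 < δ) (hK : 0 ≤ K) (hT : 0 ≤ T)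
    (hEc : ContinuousOn E (Ici 0)) (hEd : ∀ t, 0 < t → HasDerivAt E (E' t) t)
    (hE0 : ∀ t, 0 ≤ E t) (hE' : ∀ t ∈ Ioc 0 T, E' t ≤ K - δ * D t) :
    ∫ t in (0:ℝ)..T, D t ≤ (E 0 + K * T) / δ := by
  by_cases hD : IntervalIntegrable D volume 0 T
  · have h1 : IntervalIntegrable (fun t => K - δ * D t) volume 0 T :=
      intervalIntegrable_const.sub (hD.const_mul δ)
    have h := intervalIntegral.sub_le_integral_of_hasDeriv_right_of_le hT
      (hEc.mono fun s hs => hs.1) (fun t ht => (hEd t ht.1).hasDerivWithinAt)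
      ((intervalIntegrable_iff_integrableOn_Icc_of_le hT).1 h1)
      (fun t ht => hE' t ⟨ht.1, ht.2.le⟩)
    rw [intervalIntegral.integral_sub intervalIntegrable_const (hD.const_mul δ),
      intervalIntegral.integral_const_mul] at h
    simp only [intervalIntegral.integral_const, sub_zero, smul_eq_mul] at h
    rw [le_div_iff₀ hδ]
    linarith [hE0 T]
  · rw [intervalIntegral.integral_undef hD]
    have := hE0 0
    positivity

lemma abs_log_le_iff {N r : ℝ} (hN : 0 < N) (hr : 0 < r) :
    |Real.log r| ≤ Real.log N ↔ N⁻¹ ≤ r ∧ r ≤ N := by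
  rw [abs_le, ← Real.log_inv, Real.log_le_log_iff (inv_pos.2 hN) hr, Real.log_le_log_iff hr hN]

/-- The a-priori estimates with constants depending only on the data. -/
lemma exists_time_and_bound {μ κ γ M H : ℝ} {P : ℝ → ℝ} (hμ : 0 < μ) (hκ : 0 < κ) (hγ : 0 < γ)
    (hM : 0 < M) (hP : ContDiffOn ℝ 1 P (Ici 0)) :
    ∃ T C : ℝ, 0 < T ∧ 0 < C ∧ ∀ (ρ u c : ℝ → ℝ → ℝ) (ρ₀ u₀ : ℝ → ℝ),
      IsNSKSolution μ κ γ P (Ici 0) ρ u c ρ₀ u₀ → (∀ x, M⁻¹ ≤ ρ₀ x ∧ ρ₀ x ≤ M) →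
      H1norm u₀ = H →
      (∀ t ∈ Icc 0 T, ∀ x, (2 * M)⁻¹ ≤ ρ t x ∧ ρ t x ≤ 2 * M) ∧
      (⨆ t ∈ Icc 0 T, H1norm (u t) ^ 2)
        + (∫ t in (0:ℝ)..T, L2norm (fun x =>
            deriv (fun y => μ * deriv (u t) y - artificialPressure P γ (ρ t y)) x) ^ 2) ≤ C := by
  set N := 2 * M with hNdef
  have hN : 0 < N := by positivity
  obtain ⟨Q, hQ0, hQ⟩ := exists_pressure_bound (γ := γ) hP hN
  set R := (μ ^ 2 + 1) * H ^ 2 + Q ^ 2 + 2 with hRdef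
  have hR : 0 < R := by positivity
  set K := (2 * Q + N * R / μ ^ 2) * R / μ + 8 * Q * R / μ
        + (2 * N * μ * γ ^ 2 * (γ * N ^ 2 / (4 * κ)) + 4 * N ^ 3 / μ * R + 2 * Q ^ 3 / μ) with hKdef
  have hK : 0 < K := by positivity
  set δ := μ / (2 * N) with hδdef
  have hδ : 0 < δ := by positivity
  have hl2 : 0 < Real.log 2 := Real.log_pos one_lt_two
  set η := Real.log 2 / (4 * R) with hηdef
  have hη : 0 < η := by positivity
  set ε := η * (δ * μ) with hεdef
  have hε : 0 < ε := by positivity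
  set K₂ := (2 * Q + 1 / (4 * ε)) / μ + η * K + 1 with hK₂def
  have hK₂ : 0 < K₂ := by positivity
  set T := min (1 / (K + 1)) (Real.log 2 / (4 * K₂)) with hTdef
  have hT : 0 < T := by positivity
  set B := 2 / μ ^ 2 * (2 * R + Q ^ 2) with hBdef
  have hB : 0 < B := by positivity
  refine ⟨T, (2 + 2 * R + B) ^ 2 + B + (R + K * T) / δ, hT, by positivity, ?_⟩
  intro ρ u c ρ₀ u₀ h hρ₀ hH
  have hKT : K * T ≤ 1 := by
    have : T * (K + 1) ≤ 1 := (le_div_iff₀ (by positivity)).1 (min_le_left _ _)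
    linarith
  have hK₂T : K₂ * T ≤ Real.log 2 / 4 := by
    have : T * (4 * K₂) ≤ Real.log 2 := (le_div_iff₀ (by positivity)).1 (min_le_right _ _)
    linarith
  have hηR : η * R = Real.log 2 / 4 := by rw [hηdef]; field_simp
  have hlogN : Real.log N = Real.log 2 + Real.log M := Real.log_mul two_ne_zero hM.ne'
  have hE0 := fluxEnergy_nonneg μ γ P ρ u
  have hEc := h.continuousOn_fluxEnergy hP
  have hEd := fun t (ht : 0 < t) => h.hasDerivAt_fluxEnergy hP ht
  have hρiff : ∀ t, (∀ x, |Real.log (ρ t x)| ≤ Real.log N) → ∀ x, N⁻¹ ≤ ρ t x ∧ ρ t x ≤ N :=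
    fun t hb x => (abs_log_le_iff hN (h.rho_pos t x)).1 (hb x)
  have hsplit : ∀ t, fluxEnergy μ γ P ρ u t ≤ R →
      (∫ x in (0:ℝ)..1, (μ * deriv (u t) x - artificialPressure P γ (ρ t x)) ^ 2) ≤ 2 * R ∧
        (∫ x in (0:ℝ)..1, u t x) ^ 2 ≤ 2 * R := by
    intro t ht
    have h1 : 0 ≤ ∫ x in (0:ℝ)..1, (μ * deriv (u t) x - artificialPressure P γ (ρ t x)) ^ 2 :=
      intervalIntegral.integral_nonneg zero_le_one fun x _ => sq_nonneg _
    have h2 := sq_nonneg (∫ x in (0:ℝ)..1, u t x)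
    simp only [fluxEnergy, viscousFlux] at ht
    constructor <;> linarith
  set D : ℝ → ℝ := fun t => ∫ x in (0:ℝ)..1,
    (μ * deriv (deriv (u t)) x - (deriv P (ρ t x) + γ * ρ t x) * deriv (ρ t) x) ^ 2 with hDdef
  have hD0 : ∀ t, 0 ≤ D t := fun t =>
    intervalIntegral.integral_nonneg zero_le_one fun x _ => sq_nonneg _
  have hprof := fun t (ht : 0 < t) (hb : ∀ x, |Real.log (ρ t x)| ≤ Real.log N) =>
    h.isNSKProfile hP ht hQ (hρiff t hb)
  have hdiss : ∀ t, 0 < t → (∀ x, |Real.log (ρ t x)| ≤ Real.log N) →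
      fluxEnergy μ γ P ρ u t ≤ R → fluxEnergyDt μ γ P ρ u t ≤ K - δ * D t := fun t ht hb hE =>
    (hprof t ht hb).flux_dissipation hμ hκ hγ hN hR (hsplit t hE).1 (hsplit t hE).2
  have hsm0 : ∀ t, 0 ≤ t → Continuous (u t) ∧ Continuous (deriv (u t)) ∧ Continuous (ρ t) :=
    fun t ht => ⟨continuous_slice h.smooth_u ht,
      continuous_slice (F := fun t x => deriv (u t) x) (contDiffOn_deriv_space h.smooth_u) ht,
      continuous_slice h.smooth_rho ht⟩
  have hq : ∀ t, 0 ≤ t → Continuous fun x => artificialPressure P γ (ρ t x) := fun t ht =>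
    (continuousOn_artificialPressure hP).comp_continuous (hsm0 t ht).2.2 fun x => h.rho_pos t x
  have hlog0 : ∀ x, |Real.log (ρ 0 x)| ≤ Real.log M := fun x => by
    rw [abs_log_le_iff hM (h.rho_pos 0 x), h.init_rho]
    exact hρ₀ x
  have hE0R : fluxEnergy μ γ P ρ u 0 ≤ R - 2 := by
    have h1 := flux_energy_le_of_abs_le (μ := μ) (hsm0 0 le_rfl).1 (hsm0 0 le_rfl).2.1
      (hq 0 le_rfl) fun x => (hQ _ (hρiff 0 (fun x => (hlog0 x).trans (by linarith)) x).1
        (hρiff 0 (fun x => (hlog0 x).trans (by linarith)) x).2).1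
    rw [← H1norm_sq, funext h.init_u, hH] at h1
    rw [← funext h.init_u] at h1
    unfold fluxEnergy viscousFlux
    linarith
  have hmain := bootstrap_bounds (h := fun t x => Real.log (ρ t x))
    (ht := fun t x => deriv (fun s => ρ s x) t / ρ t x)
    (hx := fun t x => deriv (ρ t) x / ρ t x) (u := u) (ux := fun t => deriv (u t))
    (L := Real.log N) (L₀ := Real.log M) (R := R) (K := K) (K₂ := K₂) (T := T)
    hη.le hK.le hK₂.le
    (h.smooth_rho.continuousOn.log fun p _ => (h.rho_pos p.1 p.2).ne')
    (fun t x => by rw [h.periodic_rho])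
    (fun t ht x =>
      (differentiableAt_time h.smooth_rho ht x).hasDerivAt.log (h.rho_pos t x).ne')
    (fun t ht x =>
      (differentiableAt_space h.smooth_rho ht.le x).hasDerivAt.log (h.rho_pos t x).ne')
    (fun t ht x => by
      have h1 := h.mass t ht.le x
      rw [(show HasDerivAt (fun y => ρ t y * u t y) _ x from
        (differentiableAt_space h.smooth_rho ht.le x).hasDerivAt.mul
          (differentiableAt_space h.smooth_u ht.le x).hasDerivAt).deriv] at h1
      have h2 := (h.rho_pos t x).ne'
      field_simp
      linarith)
    hEc hEd hE0
    (fun t ht hb hE x hx => by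
      have h1 := (hprof t ht hb).abs_flux_le hε hx
      have h2 := hdiss t ht hb hE
      have h3 := (hprof t ht hb).abs_q_le x
      have h4 : μ * |deriv (u t) x| ≤ 2 * Q + 1 / (4 * ε) + ε * D t := by
        have h0 : |μ * deriv (u t) x| = μ * |deriv (u t) x| := by rw [abs_mul, abs_of_pos hμ]
        have := abs_add_le (μ * deriv (u t) x - artificialPressure P γ (ρ t x))
          (artificialPressure P γ (ρ t x))
        rw [sub_add_cancel] at this
        simp only [hDdef]
        linarith
      have h5 : |deriv (u t) x| ≤ (2 * Q + 1 / (4 * ε)) / μ + η * (δ * D t) := by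
        have : (2 * Q + 1 / (4 * ε)) / μ + η * (δ * D t)
            = (2 * Q + 1 / (4 * ε) + ε * D t) / μ := by
          have : ε * D t / μ = η * (δ * D t) := by rw [hεdef]; field_simp
          rw [add_div _ (ε * D t), this]
        rw [this, le_div_iff₀ hμ]
        linarith
      have h6 := mul_le_mul_of_nonneg_left h2 hη.le
      linarith)
    (fun t ht hb hE => (hdiss t ht hb hE).trans
      (sub_le_self _ (mul_nonneg hδ.le (hD0 t))))
    hlog0 (by linarith) (by linarith)
  have hsup : (⨆ t ∈ Icc 0 T, H1norm (u t) ^ 2) ≤ (2 + 2 * R + B) ^ 2 + B := by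
    refine Real.iSup_le (fun t => Real.iSup_le (fun ht => ?_) (by positivity)) (by positivity)
    obtain ⟨hb, hE⟩ := hmain t ht
    rw [H1norm_sq]
    exact integral_sq_add_sq_le_of_flux_energy_le hμ hR
      (fun x => (differentiableAt_space h.smooth_u ht.1 x).hasDerivAt) (hsm0 t ht.1).2.1
      (hq t ht.1) (fun x => (hQ _ (hρiff t hb x).1 (hρiff t hb x).2).1)
      (hsplit t hE).1 (hsplit t hE).2
  have hint : (∫ t in (0:ℝ)..T, L2norm (fun x =>
      deriv (fun y => μ * deriv (u t) y - artificialPressure P γ (ρ t y)) x) ^ 2)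
      ≤ (R + K * T) / δ := by
    refine (integral_dissipation_le hδ hK.le hT.le hEc hEd hE0 fun t ht => ?_).trans
      (div_le_div_of_nonneg_right (by linarith) hδ.le)
    obtain ⟨hb, hE⟩ := hmain t ⟨ht.1.le, ht.2⟩
    rw [L2norm_sq, funext fun x => ((hprof t ht.1 hb).hasDerivAt_flux x).deriv]
    exact hdiss t ht.1 hb hE
  exact ⟨fun t ht => hρiff t (hmain t ht).1, add_le_add hsup hint⟩

/-- Refined a-priori estimates for the effective viscous flux `Σ = μ ∂ₓu − P_γ(ρ)`:
there are `T₀ > 0` and `C₀ > 0`, depending only on `M₀`, `‖u₀‖_{H¹}`, `γ`, `κ`, `μ`,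
`P` and `W`, such that `(2M₀)⁻¹ ≤ ρ ≤ 2M₀` on `[0,T₀] × ℝ` and
`sup_{[0,T₀]} ‖u‖²_{H¹} + ∫₀^{T₀} ‖∂ₓΣ‖²_{L²} ≤ C₀`. -/
theorem refined_a_priori_estimates :
    ∃ T C : ℝ → ℝ → ℝ → ℝ → ℝ → (ℝ → ℝ) → (ℝ → ℝ) → ℝ,
      ∀ (μ κ γ M₀ β a : ℝ) (P W : ℝ → ℝ) (ρ u c : ℝ → ℝ → ℝ) (ρ₀ u₀ : ℝ → ℝ),
        0 < μ → 0 < κ → 0 < γ → 0 < M₀ →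
        IsAdmissiblePair P γ β a → IsPressurePotential P W →
        IsNSKSolution μ κ γ P (Set.Ici 0) ρ u c ρ₀ u₀ →
        (∀ x : ℝ, M₀⁻¹ ≤ ρ₀ x ∧ ρ₀ x ≤ M₀) →
        0 < T M₀ (H1norm u₀) γ κ μ P W ∧
        0 < C M₀ (H1norm u₀) γ κ μ P W ∧
        (∀ t ∈ Set.Icc 0 (T M₀ (H1norm u₀) γ κ μ P W), ∀ x : ℝ,
          (2 * M₀)⁻¹ ≤ ρ t x ∧ ρ t x ≤ 2 * M₀) ∧
        (⨆ t ∈ Set.Icc 0 (T M₀ (H1norm u₀) γ κ μ P W), H1norm (u t) ^ 2)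
          + (∫ t in (0:ℝ)..(T M₀ (H1norm u₀) γ κ μ P W),
              L2norm (fun x =>
                deriv (fun y => μ * deriv (u t) y - artificialPressure P γ (ρ t y)) x) ^ 2)
          ≤ C M₀ (H1norm u₀) γ κ μ P W := by
  have key : ∀ (M₀ H γ κ μ : ℝ) (P _W : ℝ → ℝ), ∃ T C : ℝ, 0 < μ → 0 < κ → 0 < γ → 0 < M₀ →
      ContDiffOn ℝ 1 P (Ici 0) → 0 < T ∧ 0 < C ∧ ∀ (ρ u c : ℝ → ℝ → ℝ) (ρ₀ u₀ : ℝ → ℝ),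
      IsNSKSolution μ κ γ P (Ici 0) ρ u c ρ₀ u₀ → (∀ x, M₀⁻¹ ≤ ρ₀ x ∧ ρ₀ x ≤ M₀) →
      H1norm u₀ = H →
      (∀ t ∈ Icc 0 T, ∀ x, (2 * M₀)⁻¹ ≤ ρ t x ∧ ρ t x ≤ 2 * M₀) ∧
      (⨆ t ∈ Icc 0 T, H1norm (u t) ^ 2)
        + (∫ t in (0:ℝ)..T, L2norm (fun x =>
            deriv (fun y => μ * deriv (u t) y - artificialPressure P γ (ρ t y)) x) ^ 2) ≤ C := by
    intro M₀ H γ κ μ P _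
    by_cases hyp : 0 < μ ∧ 0 < κ ∧ 0 < γ ∧ 0 < M₀ ∧ ContDiffOn ℝ 1 P (Ici 0)
    · obtain ⟨hμ, hκ, hγ, hM, hP⟩ := hyp
      obtain ⟨T, C, h⟩ := exists_time_and_bound (H := H) hμ hκ hγ hM hP
      exact ⟨T, C, fun _ _ _ _ _ => h⟩
    · exact ⟨0, 0, fun hμ hκ hγ hM hP => absurd ⟨hμ, hκ, hγ, hM, hP⟩ hyp⟩
  choose T C hTC using key
  refine ⟨T, C, fun μ κ γ M₀ β a P W ρ u c ρ₀ u₀ hμ hκ hγ hM hadm _ hsol hρ₀ => ?_⟩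
  obtain ⟨hT, hC, h⟩ := hTC M₀ (H1norm u₀) γ κ μ P W hμ hκ hγ hM hadm.smooth
  exact ⟨hT, hC, h ρ u c ρ₀ u₀ hsol hρ₀ rfl⟩
end
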